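/- Let m ≥ 2 and l ≥ 1 be integers and set n = l(m−1)+1. There exists an injective group homomorphism φ from T_n into T_m which is a quasi-isometric embedding: for any finite generating set Σ of T_n and any finite generating set S of T_m, there exist constants A ≥ 1 and B ≥ 0 such that for all ω ∈ T_n, (1/A)·|ω|_Σ − B ≤ |φ(ω)|_S ≤ A·|ω|_Σ + B. -/

import Mathlib

noncomputable section

namespace ThompsonPaper

/-- The circle `ℝ/ℤ`. -/
abbrev Circle : Type := AddCircle (1 : ℝ)

/-- Homeomorphisms of a topological space form a group under composition,
with `(f * g) x = f (g x)`. -/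
instance homeoGroup {α : Type*} [TopologicalSpace α] : Group (α ≃ₜ α) where
  mul f g := g.trans f
  one := Homeomorph.refl α
  inv := Homeomorph.symm
  mul_assoc _ _ _ := Homeomorph.ext fun _ => rfl
  one_mul _ := Homeomorph.ext fun _ => rfl
  mul_one _ := Homeomorph.ext fun _ => rfl
  inv_mul_cancel f := Homeomorph.ext fun x => f.symm_apply_apply x

/-- `x` is an `n`-adic rational: `x = a / n ^ k` with `a` an integer, `k` a natural number. -/
def IsNAdic (n : ℕ) (x : ℝ) : Prop := ∃ a : ℤ, ∃ k : ℕ, x = (a : ℝ) / (n : ℝ) ^ k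

/-- The set of `n`-adic points of the circle. -/
def nAdicPoints (n : ℕ) : Set Circle := { p | ∃ x : ℝ, IsNAdic n x ∧ p = (x : Circle) }

/-- `F : ℝ → ℝ` is a lift of the circle map `f`. -/
def IsLift (f : Circle ≃ₜ Circle) (F : ℝ → ℝ) : Prop :=
  ∀ x : ℝ, f (x : Circle) = ((F x : ℝ) : Circle)

/-- `F : ℝ → ℝ` commutes with translation by `1` and is piecewise affine with finitely
many breakpoints (modulo `1`), all breakpoints at `n`-adic rationals, and with the slope
of every affine piece an integer power of `n`. -/
def PiecewiseNAffine (n : ℕ) (F : ℝ → ℝ) : Prop :=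
  (∀ x : ℝ, F (x + 1) = F x + 1) ∧
  ∃ m : ℕ, ∃ t : ℕ → ℝ, ∃ slope : ℕ → ℤ, ∃ c : ℕ → ℝ,
    0 < m ∧ t 0 = 0 ∧ t m = 1 ∧
    (∀ i, i < m → t i < t (i + 1)) ∧
    (∀ i, i ≤ m → IsNAdic n (t i)) ∧
    (∀ i, i < m → ∀ x ∈ Set.Icc (t i) (t (i + 1)),
      F x = (n : ℝ) ^ (slope i) * x + c i)

/-- Membership in Thompson's group `T_n`: an orientation-preserving homeomorphism of the
circle `ℝ/ℤ` mapping the set of `n`-adic points onto itself, which is piecewise affine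
with finitely many breakpoints, all breakpoints at `n`-adic points, and all slopes integer
powers of `n`.  (Orientation preservation and the piecewise affine structure are expressed
through a strictly increasing lift.) -/
def InT (n : ℕ) (f : Circle ≃ₜ Circle) : Prop :=
  f '' nAdicPoints n = nAdicPoints n ∧
  ∃ F : ℝ → ℝ, StrictMono F ∧ IsLift f F ∧ PiecewiseNAffine n F

/-- Thompson's group `T_n`, as a set of circle homeomorphisms. -/
def TnSet (n : ℕ) : Set (Circle ≃ₜ Circle) := { f | InT n f }

/-- Thompson's group `T_n`, as a subgroup of the homeomorphism group of the circle.
(The set `TnSet n` is closed under the group operations, so this subgroup has exactly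
`TnSet n` as its underlying set.) -/
def Tn (n : ℕ) : Subgroup (Circle ≃ₜ Circle) := Subgroup.closure (TnSet n)

/-- The word length of `g` with respect to a set `S` of generators: the least `k` such
that `g` is a product of `k` elements of `S ∪ S⁻¹`. -/
def wordLength {G : Type*} [Group G] (S : Set G) (g : G) : ℕ :=
  sInf { k : ℕ | ∃ w : List G, w.length = k ∧ (∀ x ∈ w, x ∈ S ∨ x⁻¹ ∈ S) ∧ w.prod = g }



theorem hmul_apply (f g : Circle ≃ₜ Circle) (x : Circle) : (f * g) x = f (g x) := rfl
theorem hone_apply (x : Circle) : (1 : Circle ≃ₜ Circle) x = x := rfl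
theorem hinv_apply_self (f : Circle ≃ₜ Circle) (x : Circle) : f⁻¹ (f x) = x :=
  f.symm_apply_apply x

/-- The affine map onto the standard interval of a word. -/
def aff {d : ℕ} : List (Fin (d + 1)) → ℝ → ℝ
  | [], x => x
  | k :: v, x => ((k : ℕ) + aff v x) / ((d : ℝ) + 1)

theorem aff_append {d : ℕ} (v w : List (Fin (d + 1))) (x : ℝ) :
    aff (v ++ w) x = aff v (aff w x) := by
  induction v with
  | nil => rfl
  | cons k v ih => simp [aff, ih]

theorem aff_eq {d : ℕ} (v : List (Fin (d + 1))) (x : ℝ) :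
    aff v x = aff v 0 + x / ((d : ℝ) + 1) ^ v.length := by
  induction v with
  | nil => simp [aff]
  | cons k v ih =>
    have : (d : ℝ) + 1 ≠ 0 := by positivity
    simp only [aff, List.length_cons]
    rw [ih]; field_simp; ring

theorem fin_cast_le {d : ℕ} (k : Fin (d + 1)) : ((k : ℕ) : ℝ) ≤ d := by
  have := k.2
  exact_mod_cast (by omega : (k : ℕ) ≤ d)

theorem aff_mem_Icc {d : ℕ} (v : List (Fin (d + 1))) {x : ℝ} (hx : x ∈ Set.Icc (0 : ℝ) 1) :
    aff v x ∈ Set.Icc (0 : ℝ) 1 := by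
  induction v with
  | nil => exact hx
  | cons k v ih =>
    have h0 : (0 : ℝ) < (d : ℝ) + 1 := by positivity
    have hk := fin_cast_le k
    have hk' : (0 : ℝ) ≤ ((k : ℕ) : ℝ) := by positivity
    obtain ⟨h1, h2⟩ := ih
    simp only [aff]
    constructor
    · positivity
    · rw [div_le_one h0]; linarith

theorem aff_mem_Ico {d : ℕ} (v : List (Fin (d + 1))) {x : ℝ} (hx : x ∈ Set.Ico (0 : ℝ) 1) :
    aff v x ∈ Set.Ico (0 : ℝ) 1 := by
  induction v with
  | nil => exact hx
  | cons k v ih =>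
    have h0 : (0 : ℝ) < (d : ℝ) + 1 := by positivity
    have hk := fin_cast_le k
    have hk' : (0 : ℝ) ≤ ((k : ℕ) : ℝ) := by positivity
    obtain ⟨h1, h2⟩ := ih
    simp only [aff]
    constructor
    · positivity
    · rw [div_lt_one h0]; linarith

theorem coe_inj_Ico {x y : ℝ} (hx : x ∈ Set.Ico (0 : ℝ) 1) (hy : y ∈ Set.Ico (0 : ℝ) 1)
    (h : (x : Circle) = (y : Circle)) : x = y := by
  haveI : Fact ((0 : ℝ) < 1) := ⟨one_pos⟩
  refine (AddCircle.coe_eq_coe_iff_of_mem_Ico (p := (1 : ℝ)) (a := 0) ?_ ?_).1 h <;> simpa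

theorem coe_eq_iff (x y : ℝ) : (x : Circle) = (y : Circle) ↔ ∃ z : ℤ, x = y + z := by
  rw [← sub_eq_zero, ← AddCircle.coe_sub, AddCircle.coe_eq_zero_iff]
  constructor
  · rintro ⟨z, hz⟩; exact ⟨z, by simp at hz; linarith⟩
  · rintro ⟨z, hz⟩; exact ⟨z, by simp; linarith⟩

theorem coe_one : ((1 : ℝ) : Circle) = ((0 : ℝ) : Circle) :=
  (coe_eq_iff _ _).2 ⟨1, by simp⟩

theorem exists_rep (p : Circle) : ∃ x ∈ Set.Ico (0 : ℝ) 1, (x : Circle) = p := by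
  induction p using QuotientAddGroup.induction_on with
  | H z =>
    refine ⟨Int.fract z, ⟨Int.fract_nonneg z, Int.fract_lt_one z⟩, ?_⟩
    refine (coe_eq_iff _ _).2 ⟨-⌊z⌋, ?_⟩
    push_cast
    linarith [Int.self_sub_floor z]

theorem head_eq {d : ℕ} {k k' : Fin (d + 1)} {x y : ℝ} (hx : x ∈ Set.Ico (0 : ℝ) 1)
    (hy : y ∈ Set.Ico (0 : ℝ) 1)
    (h : ((k : ℕ) + x) / ((d : ℝ) + 1) = ((k' : ℕ) + y) / ((d : ℝ) + 1)) : k = k' ∧ x = y := by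
  have h0 : (d : ℝ) + 1 ≠ 0 := by positivity
  rw [div_left_inj' h0] at h
  have hk : (k : ℕ) = k' := by
    have h1 : ((k : ℕ) : ℝ) < (k' : ℕ) + 1 := by linarith [hx.1, hy.2]
    have h2 : ((k' : ℕ) : ℝ) < (k : ℕ) + 1 := by linarith [hx.2, hy.1]
    have h1' : (k : ℕ) < k' + 1 := by exact_mod_cast h1
    have h2' : (k' : ℕ) < k + 1 := by exact_mod_cast h2
    omega
  refine ⟨Fin.ext hk, ?_⟩
  rw [hk] at h; linarith

theorem prefix_of_overlap {d : ℕ} (v w : List (Fin (d + 1))) {x y : ℝ}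
    (hx : x ∈ Set.Ico (0 : ℝ) 1) (hy : y ∈ Set.Ico (0 : ℝ) 1) (h : aff v x = aff w y)
    (hl : v.length ≤ w.length) : ∃ s, w = v ++ s := by
  induction v generalizing w with
  | nil => exact ⟨w, rfl⟩
  | cons k v ih =>
    cases w with
    | nil => simp at hl
    | cons k' w =>
      obtain ⟨rfl, h2⟩ := head_eq (aff_mem_Ico v hx) (aff_mem_Ico w hy) h
      obtain ⟨s, rfl⟩ := ih w h2 (by simpa using hl)
      exact ⟨s, rfl⟩

theorem aff_inj {d : ℕ} (hd : 1 ≤ d) (v w : List (Fin (d + 1)))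
    (h : ∀ x ∈ Set.Ico (0 : ℝ) 1, aff v x = aff w x) : v = w := by
  have hd' : (1 : ℝ) ≤ d := by exact_mod_cast hd
  have key : v.length = w.length := by
    have h0 := h 0 (by norm_num)
    have h1 := h (1/2) (by norm_num)
    rw [aff_eq v, aff_eq w, h0] at h1
    have h2 : ((d : ℝ) + 1) ^ v.length = ((d : ℝ) + 1) ^ w.length := by
      have := add_left_cancel h1
      rw [div_eq_div_iff (by positivity) (by positivity)] at this
      linarith
    exact pow_right_injective₀ (by linarith) (by linarith) h2
  have h0 := h 0 (by norm_num)
  obtain ⟨s, rfl⟩ := prefix_of_overlap v w (by norm_num) (by norm_num) h0 key.le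
  have : s = [] := by
    simp at key; exact key
  simp [this]

theorem exists_digits {d : ℕ} (k : ℕ) (y : ℝ) (hy : y ∈ Set.Ico (0 : ℝ) 1) :
    ∃ v : List (Fin (d + 1)), v.length = k ∧ ∃ x ∈ Set.Ico (0 : ℝ) 1, aff v x = y := by
  induction k generalizing y with
  | zero => exact ⟨[], rfl, y, hy, rfl⟩
  | succ k ih =>
    have h0 : (0 : ℝ) < (d : ℝ) + 1 := by positivity
    have hnn : 0 ≤ y * ((d : ℝ) + 1) := mul_nonneg hy.1 h0.le
    have hlt : ⌊y * ((d : ℝ) + 1)⌋₊ < d + 1 := by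
      rw [Nat.floor_lt hnn]; push_cast; nlinarith [hy.2]
    obtain ⟨v, hv, x, hx, hxy⟩ := ih (y * ((d : ℝ) + 1) - ⌊y * ((d : ℝ) + 1)⌋₊)
      ⟨by linarith [Nat.floor_le hnn], by linarith [Nat.lt_floor_add_one (y * ((d : ℝ) + 1))]⟩
    refine ⟨⟨_, hlt⟩ :: v, by simp [hv], x, hx, ?_⟩
    simp only [aff, hxy]
    field_simp; ring

/-- `f` maps the standard interval of `v` affinely onto the one of `u`. -/
def Carry {d : ℕ} (f : Circle ≃ₜ Circle) (v u : List (Fin (d + 1))) : Prop :=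
  ∀ x ∈ Set.Icc (0 : ℝ) 1, f (aff v x : ℝ) = ((aff u x : ℝ) : Circle)

theorem Carry.append {d : ℕ} {f : Circle ≃ₜ Circle} {v u : List (Fin (d + 1))}
    (h : Carry f v u) (w : List (Fin (d + 1))) : Carry f (v ++ w) (u ++ w) := by
  intro x hx
  rw [aff_append, aff_append]
  exact h _ (aff_mem_Icc w hx)

theorem Carry.comp {d : ℕ} {f g : Circle ≃ₜ Circle} {v u w : List (Fin (d + 1))}
    (hf : Carry f u w) (hg : Carry g v u) : Carry (f * g) v w := by
  intro x hx
  rw [hmul_apply, hg x hx, hf x hx]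

theorem Carry.inv {d : ℕ} {f : Circle ≃ₜ Circle} {v u : List (Fin (d + 1))}
    (h : Carry f v u) : Carry f⁻¹ u v := by
  intro x hx
  rw [← h x hx, hinv_apply_self]

theorem Carry.one {d : ℕ} (v : List (Fin (d + 1))) : Carry 1 v v := fun _ _ => rfl

theorem Carry.unique {d : ℕ} (hd : 1 ≤ d) {f : Circle ≃ₜ Circle} {v u u' : List (Fin (d + 1))}
    (h : Carry f v u) (h' : Carry f v u') : u = u' := by
  refine aff_inj hd _ _ fun x hx => ?_
  have hx' : x ∈ Set.Icc (0 : ℝ) 1 := ⟨hx.1, hx.2.le⟩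
  exact coe_inj_Ico (aff_mem_Ico u hx) (aff_mem_Ico u' hx) ((h x hx').symm.trans (h' x hx'))

theorem Carry.unique_left {d : ℕ} (hd : 1 ≤ d) {f : Circle ≃ₜ Circle}
    {v v' u : List (Fin (d + 1))}
    (h : Carry f v u) (h' : Carry f v' u) : v = v' := Carry.unique hd h.inv h'.inv

theorem Carry.nil {d : ℕ} (hd : 1 ≤ d) {f : Circle ≃ₜ Circle} {u : List (Fin (d + 1))}
    (h : Carry f [] u) : u = [] := by
  have hd' : (1 : ℝ) ≤ d := by exact_mod_cast hd
  by_contra hu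
  have h0 := h 0 (by norm_num)
  have h1 := h 1 (by norm_num)
  simp only [aff] at h0 h1
  rw [coe_one, h0, aff_eq u 1, coe_eq_iff] at h1
  obtain ⟨z, hz⟩ := h1
  have hl : u.length ≠ 0 := by simpa using hu
  have hp : 1 < ((d : ℝ) + 1) ^ u.length := one_lt_pow₀ (by linarith) hl
  have ha : 0 < 1 / ((d : ℝ) + 1) ^ u.length := by positivity
  have hb : 1 / ((d : ℝ) + 1) ^ u.length < 1 := by rw [div_lt_one (by positivity)]; exact hp
  have hz1 : (z : ℝ) < 0 := by linarith
  have hz2 : (-1 : ℝ) < z := by linarith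
  have hz1' : z < 0 := by exact_mod_cast hz1
  have hz2' : -1 < z := by exact_mod_cast hz2
  omega

theorem Carry.nil_right {d : ℕ} (hd : 1 ≤ d) {f : Circle ≃ₜ Circle} {v : List (Fin (d + 1))}
    (h : Carry f v []) : v = [] := h.inv.nil hd

/-- Words whose standard interval is not carried to a standard interval. -/
def Irr (d : ℕ) (f : Circle ≃ₜ Circle) : Set (List (Fin (d + 1))) := {v | ¬ ∃ u, Carry f v u}

theorem Irr_one (d : ℕ) : Irr d 1 = ∅ := by
  ext v; simp only [Irr, Set.mem_setOf_eq, Set.mem_empty_iff_false, iff_false, not_not]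
  exact ⟨v, Carry.one v⟩

theorem Irr_mul_aux {d : ℕ} (hd : 1 ≤ d) (f g : Circle ≃ₜ Circle) (hf : (Irr d f).Finite)
    (hg : (Irr d g).Finite) : (Irr d (f * g)).Finite ∧
      (Irr d (f * g)).ncard ≤ (Irr d f).ncard + (Irr d g).ncard := by
  classical
  -- the injection
  let F : List (Fin (d + 1)) → List (Fin (d + 1)) ⊕ List (Fin (d + 1)) := fun v =>
    if h : ∃ u, Carry g v u then Sum.inl h.choose else Sum.inr v
  have hF : Function.Injective F := by
    intro v w hvw
    simp only [F] at hvw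
    split_ifs at hvw with h1 h2 h2
    · have e := Sum.inl.inj hvw
      have a1 := h1.choose_spec
      rw [e] at a1
      exact a1.unique_left hd h2.choose_spec
    · exact Sum.inr.inj hvw
  have hmaps : Set.MapsTo F (Irr d (f * g)) (Sum.inl '' Irr d f ∪ Sum.inr '' Irr d g) := by
    intro v hv
    by_cases h : ∃ u, Carry g v u
    · left
      refine ⟨h.choose, ?_, by simp only [F, dif_pos h]⟩
      rintro ⟨w, hw⟩
      exact hv ⟨w, hw.comp h.choose_spec⟩
    · right
      exact ⟨v, h, by simp only [F, dif_neg h]⟩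
  have hfin : (Sum.inl '' Irr d f ∪ Sum.inr '' Irr d g :
      Set (List (Fin (d + 1)) ⊕ List (Fin (d + 1)))).Finite := (hf.image _).union (hg.image _)
  refine ⟨Set.Finite.of_finite_image (hfin.subset hmaps.image_subset) hF.injOn, ?_⟩
  calc (Irr d (f * g)).ncard ≤ _ := Set.ncard_le_ncard_of_injOn F hmaps hF.injOn hfin
    _ ≤ _ := Set.ncard_union_le _ _
    _ ≤ _ := add_le_add (Set.ncard_image_le hf) (Set.ncard_image_le hg)

theorem exists_reg {d : ℕ} {f : Circle ≃ₜ Circle} (hf : (Irr d f).Finite) :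
    ∃ k : ℕ, ∀ v : List (Fin (d + 1)), k ≤ v.length → ∃ u, Carry f v u := by
  obtain ⟨k, hk⟩ := (hf.image List.length).bddAbove
  refine ⟨k + 1, fun v hv => ?_⟩
  by_contra h
  have := hk ⟨v, h, rfl⟩
  omega

theorem exists_reg' {d : ℕ} {f : Circle ≃ₜ Circle} (hf : (Irr d f).Finite) :
    ∃ k : ℕ, 1 ≤ k ∧ ∀ v : List (Fin (d + 1)), k ≤ v.length → ∃ u, u ≠ [] ∧ Carry f v u := by
  obtain ⟨k, hk⟩ := exists_reg hf
  refine ⟨k + 1, by omega, fun v hv => ?_⟩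
  have hne : v ≠ [] := by rintro rfl; simp at hv
  obtain ⟨u, hu⟩ := hk v.dropLast (by simp; omega)
  have := hu.append [v.getLast hne]
  rw [List.dropLast_append_getLast] at this
  exact ⟨_, by simp, this⟩

theorem finite_words (d k : ℕ) : {v : List (Fin (d + 1)) | v.length < k}.Finite :=
  List.finite_length_lt _ _

theorem Irr_finite_of {d k : ℕ} {f : Circle ≃ₜ Circle}
    (h : ∀ v : List (Fin (d + 1)), k ≤ v.length → ∃ u, Carry f v u) : (Irr d f).Finite := by
  refine (finite_words d k).subset fun v hv => ?_
  by_contra hc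
  exact hv (h v (by simpa using hc))

theorem Irr_inv_finite {d : ℕ} {f : Circle ≃ₜ Circle} (hf : (Irr d f).Finite) :
    (Irr d f⁻¹).Finite := by
  classical
  obtain ⟨k, hk⟩ := exists_reg hf
  choose! c hc using hk
  have hfin : ((fun v => (c v).length) '' {v : List (Fin (d + 1)) | v.length < k + 1}).Finite :=
    (finite_words d (k + 1)).image _
  obtain ⟨M, hM⟩ := hfin.bddAbove
  refine Irr_finite_of (k := M) fun w hw => ?_
  obtain ⟨y, hy, hy2⟩ := exists_rep (f⁻¹ ((aff w (1 / 2) : ℝ) : Circle))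
  obtain ⟨v, hv, x, hx, rfl⟩ := exists_digits (d := d) k y hy
  have h1 := hc v hv.ge x ⟨hx.1, hx.2.le⟩
  rw [hy2] at h1
  have h2 : f (f⁻¹ ((aff w (1 / 2) : ℝ) : Circle)) = ((aff w (1 / 2) : ℝ) : Circle) :=
    f.apply_symm_apply _
  rw [h2] at h1
  have hh : (1 / 2 : ℝ) ∈ Set.Ico (0 : ℝ) 1 := by norm_num
  have h3 := coe_inj_Ico (aff_mem_Ico w hh) (aff_mem_Ico _ hx) h1
  obtain ⟨s, rfl⟩ := prefix_of_overlap (c v) w hx hh h3.symm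
    (le_trans (hM ⟨v, by simp [hv], rfl⟩) hw)
  exact ⟨_, (hc v hv.ge).inv.append s⟩


theorem exists_nat_aff {d : ℕ} (v : List (Fin (d + 1))) :
    ∃ a : ℕ, aff v 0 = (a : ℝ) / ((d : ℝ) + 1) ^ v.length := by
  induction v with
  | nil => exact ⟨0, by simp [aff]⟩
  | cons k v ih =>
    obtain ⟨a, ha⟩ := ih
    refine ⟨k * (d + 1) ^ v.length + a, ?_⟩
    have : (d : ℝ) + 1 ≠ 0 := by positivity
    simp only [aff, ha, List.length_cons]
    push_cast
    field_simp
    ring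

theorem word_of_int {d : ℕ} (e : ℕ) (B : ℤ) : ∃ u : List (Fin (d + 1)), u.length = e ∧
    ∃ z : ℤ, ∀ x : ℝ, aff u x = (B + x) / ((d : ℝ) + 1) ^ e + z := by
  induction e generalizing B with
  | zero => exact ⟨[], rfl, -B, fun x => by simp [aff]⟩
  | succ e ih =>
    obtain ⟨u, hu, z, hz⟩ := ih (B / ((d : ℤ) + 1))
    have hpos : (0 : ℤ) < (d : ℤ) + 1 := by positivity
    have h1 := Int.emod_nonneg B hpos.ne'
    have h2 := Int.emod_lt_of_pos B hpos
    have h3 := Int.mul_ediv_add_emod B ((d : ℤ) + 1)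
    refine ⟨u ++ [⟨(B % ((d : ℤ) + 1)).toNat, by omega⟩], by simp [hu], z, fun x => ?_⟩
    rw [aff_append, hz]
    have hne : (d : ℝ) + 1 ≠ 0 := by positivity
    have h4 : (((B % ((d : ℤ) + 1)).toNat : ℕ) : ℝ) = ((B % ((d : ℤ) + 1) : ℤ) : ℝ) := by
      exact_mod_cast congrArg (Int.cast : ℤ → ℝ) (Int.toNat_of_nonneg h1)
    have h5 : (B : ℝ) = ((d : ℝ) + 1) * ((B / ((d : ℤ) + 1) : ℤ) : ℝ)
        + ((B % ((d : ℤ) + 1) : ℤ) : ℝ) := by exact_mod_cast h3.symm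
    simp only [aff, h4]
    rw [h5]
    field_simp
    ring

theorem IsNAdic.exists_mul {d : ℕ} {x : ℝ} (h : IsNAdic (d + 1) x) :
    ∃ K : ℕ, ∀ k, K ≤ k → ∃ a : ℤ, x * ((d : ℝ) + 1) ^ k = a := by
  obtain ⟨a, K, rfl⟩ := h
  refine ⟨K, fun k hk => ⟨a * (d + 1) ^ (k - K), ?_⟩⟩
  have hne : (d : ℝ) + 1 ≠ 0 := by positivity
  obtain ⟨j, rfl⟩ := Nat.exists_eq_add_of_le hk
  push_cast
  rw [pow_add, Nat.add_sub_cancel_left]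
  field_simp

theorem exists_piece (t : ℕ → ℝ) (m : ℕ) (y : ℝ) (h0 : t 0 ≤ y) (hm : y < t m) :
    ∃ i < m, t i ≤ y ∧ y < t (i + 1) := by
  induction m with
  | zero => linarith
  | succ m ih =>
    rcases lt_or_ge y (t m) with h | h
    · obtain ⟨i, hi, h'⟩ := ih h; exact ⟨i, by omega, h'⟩
    · exact ⟨m, by omega, h, hm⟩

theorem isNAdic_of_coe {d : ℕ} {x : ℝ} (h : (x : Circle) ∈ nAdicPoints (d + 1)) :
    IsNAdic (d + 1) x := by
  obtain ⟨y, ⟨a, k, rfl⟩, hy⟩ := h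
  obtain ⟨z, rfl⟩ := (coe_eq_iff _ _).1 hy
  refine ⟨a + z * (d + 1) ^ k, k, ?_⟩
  have hne : (d : ℝ) + 1 ≠ 0 := by positivity
  push_cast
  field_simp

theorem exists_unif (m : ℕ) (P : ℕ → ℕ → Prop) (h : ∀ i ≤ m, ∃ K, ∀ k, K ≤ k → P i k) :
    ∃ K, ∀ k, K ≤ k → ∀ i ≤ m, P i k := by
  choose! K hK using h
  refine ⟨(Finset.range (m + 1)).sup K, fun k hk i hi => hK i hi k (le_trans ?_ hk)⟩
  exact Finset.le_sup (f := K) (by simp; omega)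

theorem Irr_finite_of_InT {d : ℕ} {f : Circle ≃ₜ Circle} (h : InT (d + 1) f) :
    (Irr d f).Finite := by
  obtain ⟨himg, F, hF, hlift, -, m, t, slope, c, hm, ht0, ht1, htlt, htn, haff⟩ := h
  have hFt : ∀ i ≤ m, IsNAdic (d + 1) (F (t i)) := fun i hi => by
    apply isNAdic_of_coe
    rw [← hlift, ← himg]
    exact ⟨_, ⟨t i, htn i hi, rfl⟩, rfl⟩
  obtain ⟨K1, hK1⟩ := exists_unif m _ fun i hi => (htn i hi).exists_mul
  obtain ⟨K2, hK2⟩ := exists_unif m _ fun i hi => (hFt i hi).exists_mul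
  obtain ⟨S, hS⟩ := exists_unif m (fun i k => (slope i).natAbs ≤ k)
    fun i _ => ⟨_, fun _ h => h⟩
  refine Irr_finite_of (k := K1 + K2 + S) fun v hv => ?_
  set k := v.length with hk
  have h01 : (0 : ℝ) ∈ Set.Ico (0 : ℝ) 1 := by norm_num
  obtain ⟨hv0, hv1⟩ := aff_mem_Ico v h01
  obtain ⟨i, hi, hi1, hi2⟩ := exists_piece t m (aff v 0) (by rwa [ht0]) (by rwa [ht1])
  obtain ⟨a, ha⟩ := exists_nat_aff v
  have hne : (d : ℝ) + 1 ≠ 0 := by positivity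
  have hpos : (0 : ℝ) < ((d : ℝ) + 1) ^ k := by positivity
  rw [← hk] at ha
  obtain ⟨T1, hT1⟩ := hK1 k (by omega) (i + 1) (by omega)
  obtain ⟨T0, hT0⟩ := hK1 k (by omega) i (by omega)
  have hs := hS S le_rfl i hi.le
  obtain ⟨e, he⟩ : ∃ e : ℕ, (e : ℤ) = k - slope i := ⟨(k - slope i).toNat, by omega⟩
  obtain ⟨Y, hY⟩ := hK2 e (by omega) i hi.le
  have hin : ∀ x ∈ Set.Icc (0 : ℝ) 1, aff v x ∈ Set.Icc (t i) (t (i + 1)) := by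
    intro x hx
    rw [aff_eq, ← hk]
    constructor
    · have : 0 ≤ x / ((d : ℝ) + 1) ^ k := div_nonneg hx.1 hpos.le
      linarith
    · have h1 : (a : ℝ) < T1 := by
        rw [← hT1, ← div_lt_iff₀ hpos, ← ha]; exact hi2
      have h2 : (a : ℤ) + 1 ≤ T1 := by
        have : (a : ℤ) < T1 := by exact_mod_cast h1
        omega
      have h3 : (a : ℝ) + 1 ≤ T1 := by exact_mod_cast h2
      have h4 : t (i + 1) = T1 / ((d : ℝ) + 1) ^ k := by rw [← hT1]; field_simp
      rw [ha, h4, ← add_div]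
      apply div_le_div_of_nonneg_right _ hpos.le
      linarith [hx.2]
  obtain ⟨u, hu, z, hz⟩ := word_of_int (d := d) e (Y + a - T0)
  refine ⟨u, fun x hx => ?_⟩
  rw [hlift, hz, coe_eq_iff]
  refine ⟨-z, ?_⟩
  have e1 := haff i hi _ (hin x hx)
  have e2 := haff i hi (t i) ⟨le_rfl, (htlt i hi).le⟩
  have e3 : (((d + 1 : ℕ) : ℝ)) ^ slope i = ((d : ℝ) + 1) ^ k / ((d : ℝ) + 1) ^ e := by
    rw [show slope i = (k : ℤ) - e by omega, zpow_sub₀ (by exact_mod_cast hne)]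
    push_cast; simp
  rw [e3] at e1 e2
  rw [e1, aff_eq, ← hk, ha]
  push_cast
  rw [← hY, ← hT0, e2]
  field_simp
  ring

/-- Circle homeomorphism from a lift. -/
theorem lift_add_int {F : ℝ → ℝ} (h : ∀ x, F (x + 1) = F x + 1) (x : ℝ) (z : ℤ) :
    F (x + z) = F x + z := by
  have hn : ∀ (n : ℕ) (x : ℝ), F (x + n) = F x + n := by
    intro n
    induction n with
    | zero => simp
    | succ n ih => intro x; push_cast; rw [← add_assoc, h, ih]; ring
  obtain ⟨n, rfl | rfl⟩ := z.eq_nat_or_neg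
  · exact_mod_cast hn n x
  · have := hn n (x + ((-(n : ℤ) : ℤ) : ℝ))
    push_cast at this ⊢
    rw [neg_add_cancel_right] at this
    linarith

theorem symm_add_one {E : ℝ ≃o ℝ} (h : ∀ x, E (x + 1) = E x + 1) (x : ℝ) :
    E.symm (x + 1) = E.symm x + 1 := by
  rw [OrderIso.symm_apply_eq, h, OrderIso.apply_symm_apply]

def circFun (E : ℝ ≃o ℝ) (h : ∀ x, E (x + 1) = E x + 1) : Circle → Circle :=
  Function.Periodic.lift (f := fun x : ℝ => ((E x : ℝ) : Circle)) (c := (1 : ℝ)) (by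
    intro x
    exact (coe_eq_iff _ _).2 ⟨1, by rw [h]; simp⟩)

theorem circFun_coe (E : ℝ ≃o ℝ) (h : ∀ x, E (x + 1) = E x + 1) (x : ℝ) :
    circFun E h (x : Circle) = ((E x : ℝ) : Circle) := rfl

theorem circFun_continuous (E : ℝ ≃o ℝ) (h : ∀ x, E (x + 1) = E x + 1) :
    Continuous (circFun E h) := by
  apply continuous_quot_lift
  exact (AddCircle.continuous_mk' (1 : ℝ)).comp E.continuous

def circ (E : ℝ ≃o ℝ) (h : ∀ x, E (x + 1) = E x + 1) : Circle ≃ₜ Circle where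
  toFun := circFun E h
  invFun := circFun E.symm (symm_add_one h)
  left_inv p := by
    induction p using QuotientAddGroup.induction_on with
    | H z => rw [circFun_coe, circFun_coe, OrderIso.symm_apply_apply]
  right_inv p := by
    induction p using QuotientAddGroup.induction_on with
    | H z => rw [circFun_coe, circFun_coe, OrderIso.apply_symm_apply]
  continuous_toFun := circFun_continuous _ _
  continuous_invFun := circFun_continuous _ _

theorem circ_coe (E : ℝ ≃o ℝ) (h : ∀ x, E (x + 1) = E x + 1) (x : ℝ) :
    circ E h (x : Circle) = ((E x : ℝ) : Circle) := rfl

theorem circ_inv_coe (E : ℝ ≃o ℝ) (h : ∀ x, E (x + 1) = E x + 1) (x : ℝ) :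
    (circ E h)⁻¹ (x : Circle) = ((E.symm x : ℝ) : Circle) := rfl

theorem nAdic_maps {d : ℕ} {f : Circle ≃ₜ Circle} (hf : (Irr d f).Finite) {p : Circle}
    (hp : p ∈ nAdicPoints (d + 1)) : f p ∈ nAdicPoints (d + 1) := by
  obtain ⟨x, hx, rfl⟩ := hp
  obtain ⟨K, hK⟩ := hx.exists_mul
  obtain ⟨k, hk⟩ := exists_reg hf
  obtain ⟨a, ha⟩ := hK (K + k) (by omega)
  have hne : (d : ℝ) + 1 ≠ 0 := by positivity
  obtain ⟨v, hv, z, hz⟩ := word_of_int (d := d) (K + k) a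
  have hx' : (x : Circle) = ((aff v 0 : ℝ) : Circle) := by
    rw [hz, ← ha, coe_eq_iff]
    exact ⟨-z, by push_cast; field_simp; ring⟩
  obtain ⟨u, hu⟩ := hk v (by omega)
  rw [hx', hu 0 (by norm_num)]
  obtain ⟨b, hb⟩ := exists_nat_aff u
  exact ⟨_, ⟨b, u.length, by rw [hb]; push_cast; rfl⟩, rfl⟩

theorem InT_of_Irr_finite {d : ℕ} (hd : 1 ≤ d) {f : Circle ≃ₜ Circle} (hf : (Irr d f).Finite)
    (E : ℝ ≃o ℝ) (hE : ∀ x, E (x + 1) = E x + 1) (hl : IsLift f E) : InT (d + 1) f := by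
  have hd' : (1 : ℝ) ≤ d := by exact_mod_cast hd
  refine ⟨?_, E, E.strictMono, hl, hE, ?_⟩
  · apply Set.Subset.antisymm
    · rintro _ ⟨p, hp, rfl⟩; exact nAdic_maps hf hp
    · intro p hp
      exact ⟨f⁻¹ p, nAdic_maps (Irr_inv_finite hf) hp, f.apply_symm_apply p⟩
  obtain ⟨k, hk1, hk⟩ := exists_reg' hf
  have hne : (d : ℝ) + 1 ≠ 0 := by positivity
  have hpos : (0 : ℝ) < ((d : ℝ) + 1) ^ k := by positivity
  have key : ∀ i : ℕ, ∃ (s : ℤ) (c : ℝ), ∀ x ∈ Set.Icc ((i : ℝ) / ((d : ℝ) + 1) ^ k)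
      (((i + 1 : ℕ) : ℝ) / ((d : ℝ) + 1) ^ k), E x = ((d + 1 : ℕ) : ℝ) ^ s * x + c := by
    intro i
    obtain ⟨v, hv, z, hz⟩ := word_of_int (d := d) k i
    obtain ⟨u, hune, hu⟩ := hk v hv.ge
    refine ⟨k - u.length, E (i / ((d : ℝ) + 1) ^ k) -
      ((d + 1 : ℕ) : ℝ) ^ ((k : ℤ) - u.length) * (i / ((d : ℝ) + 1) ^ k), fun x hx => ?_⟩
    set t := (i : ℝ) / ((d : ℝ) + 1) ^ k with ht
    set y := (x - t) * ((d : ℝ) + 1) ^ k with hy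
    have hxy : x = (i + y) / ((d : ℝ) + 1) ^ k := by rw [hy, ht]; field_simp; ring
    have hy0 : 0 ≤ y := mul_nonneg (by linarith [hx.1]) hpos.le
    have hy1 : y ≤ 1 := by
      have := hx.2
      rw [hxy, div_le_div_iff_of_pos_right hpos] at this
      push_cast at this; linarith
    have c0 : ∀ y ∈ Set.Icc (0 : ℝ) 1, ∃ w : ℤ, E ((i + y) / ((d : ℝ) + 1) ^ k) = aff u y + w := by
      intro y hy
      have := hu y hy
      rw [hl, coe_eq_iff, hz] at this
      obtain ⟨w, hw⟩ := this
      rw [lift_add_int hE] at hw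
      refine ⟨w - z, ?_⟩
      push_cast at hw ⊢; linarith
    obtain ⟨w0, h0⟩ := c0 0 (by norm_num)
    obtain ⟨w1, h1⟩ := c0 y ⟨hy0, hy1⟩
    rw [← hxy] at h1
    rw [add_zero, ← ht] at h0
    rw [aff_eq] at h1
    have g1 : E t ≤ E x := E.monotone hx.1
    have g2 : E x < E t + 1 := by
      rw [← hE]; apply E.strictMono
      have : (1 : ℝ) < ((d : ℝ) + 1) ^ k := one_lt_pow₀ (by linarith) (by omega)
      rw [hxy, add_div, ← ht]
      have : y / ((d : ℝ) + 1) ^ k < 1 := by rw [div_lt_one hpos]; linarith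
      linarith
    have g3 : 0 ≤ y / ((d : ℝ) + 1) ^ u.length := by positivity
    have g4 : y / ((d : ℝ) + 1) ^ u.length < 1 := by
      have : (1 : ℝ) < ((d : ℝ) + 1) ^ u.length := one_lt_pow₀ (by linarith) (by simpa using hune)
      rw [div_lt_one (by positivity)]; linarith
    have hw : w0 = w1 := by
      have a1 : (w1 : ℝ) < w0 + 1 := by linarith
      have a2 : (w0 : ℝ) < w1 + 1 := by linarith
      have a1' : w1 < w0 + 1 := by exact_mod_cast a1
      have a2' : w0 < w1 + 1 := by exact_mod_cast a2
      omega
    subst hw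
    have hE' : E x = E t + y / ((d : ℝ) + 1) ^ u.length := by linarith
    rw [hE', zpow_sub₀ (by positivity)]
    push_cast
    rw [zpow_natCast, zpow_natCast, hy]
    field_simp
    ring
  choose s c hsc using key
  refine ⟨(d + 1) ^ k, fun i => (i : ℝ) / ((d : ℝ) + 1) ^ k, s, c, by positivity, by simp, ?_,
    ?_, ?_, fun i _ => hsc i⟩
  · push_cast; field_simp
  · intro i _
    rw [div_lt_div_iff_of_pos_right hpos]; push_cast; linarith
  · intro i _
    exact ⟨i, k, by push_cast; rfl⟩

theorem exists_orderIso_lift {n : ℕ} {f : Circle ≃ₜ Circle} (h : InT n f) :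
    ∃ E : ℝ ≃o ℝ, (∀ x, E (x + 1) = E x + 1) ∧ IsLift f E := by
  obtain ⟨-, F, hF, hl, h1, -⟩ := h
  have hs : Function.Surjective F := by
    intro y
    obtain ⟨x, -, hx⟩ := exists_rep (f.symm (y : Circle))
    have := hl x
    rw [hx, f.apply_symm_apply, coe_eq_iff] at this
    obtain ⟨z, hz⟩ := this
    exact ⟨x + z, by rw [lift_add_int h1, hz]⟩
  exact ⟨hF.orderIsoOfSurjective F hs, h1, hl⟩

theorem Irr_finite_of_mem {d : ℕ} (hd : 1 ≤ d) {f : Circle ≃ₜ Circle} (h : f ∈ Tn (d + 1)) :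
    (Irr d f).Finite := by
  induction h using Subgroup.closure_induction with
  | mem x hx => exact Irr_finite_of_InT hx
  | one => rw [Irr_one]; exact Set.finite_empty
  | mul x y _ _ hx hy => exact (Irr_mul_aux hd x y hx hy).1
  | inv x _ hx => exact Irr_inv_finite hx

theorem mem_Tn_of {d : ℕ} (hd : 1 ≤ d) {f : Circle ≃ₜ Circle} (hf : (Irr d f).Finite)
    (E : ℝ ≃o ℝ) (hE : ∀ x, E (x + 1) = E x + 1) (hl : IsLift f E) : f ∈ Tn (d + 1) :=
  Subgroup.subset_closure (InT_of_Irr_finite hd hf E hE hl)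

/-- Extend an order isomorphism of `[0,1]` periodically. -/
theorem exists_extend (F : ℝ → ℝ) (h0 : F 0 = 0) (h1 : F 1 = 1)
    (hm : StrictMonoOn F (Set.Icc 0 1)) (hs : ∀ y ∈ Set.Ico (0 : ℝ) 1, ∃ x ∈ Set.Ico (0 : ℝ) 1, F x = y) :
    ∃ E : ℝ ≃o ℝ, (∀ x, E (x + 1) = E x + 1) ∧ ∀ x ∈ Set.Icc (0 : ℝ) 1, E x = F x := by
  let G : ℝ → ℝ := fun x => ⌊x⌋ + F (Int.fract x)
  have fr : ∀ x : ℝ, Int.fract x ∈ Set.Icc (0 : ℝ) 1 := fun x =>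
    ⟨Int.fract_nonneg x, (Int.fract_lt_one x).le⟩
  have F0 : ∀ x : ℝ, 0 ≤ F (Int.fract x) := fun x => by
    rw [← h0]; exact hm.monotoneOn (by norm_num) (fr x) (fr x).1
  have F1 : ∀ x : ℝ, F (Int.fract x) < 1 := fun x => by
    rw [← h1]; exact hm (fr x) (by norm_num) (Int.fract_lt_one x)
  have hG : StrictMono G := by
    intro x y hxy
    simp only [G]
    rcases (Int.floor_mono hxy.le).lt_or_eq with h | h
    · have : (⌊x⌋ : ℝ) + 1 ≤ ⌊y⌋ := by exact_mod_cast h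
      linarith [F1 x, F0 y]
    · have hf : Int.fract x < Int.fract y := by
        have e1 := Int.floor_add_fract x
        have e2 := Int.floor_add_fract y
        rw [h] at e1; linarith
      rw [h]; linarith [hm (fr x) (fr y) hf]
  have hGs : Function.Surjective G := by
    intro y
    obtain ⟨x, hx, hxy⟩ := hs (Int.fract y) ⟨Int.fract_nonneg y, Int.fract_lt_one y⟩
    refine ⟨⌊y⌋ + x, ?_⟩
    have e1 : ⌊x⌋ = 0 := Int.floor_eq_zero_iff.2 hx
    simp only [G, Int.floor_intCast_add, Int.fract_intCast_add, e1, Int.fract_eq_self.2 hx, hxy]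
    simp [Int.floor_add_fract]
  refine ⟨hG.orderIsoOfSurjective G hGs, fun x => ?_, fun x hx => ?_⟩
  · change G (x + 1) = G x + 1
    simp [G]; ring
  · change G x = F x
    rcases hx.2.lt_or_eq with h | rfl
    · have e1 : ⌊x⌋ = 0 := Int.floor_eq_zero_iff.2 ⟨hx.1, h⟩
      simp [G, e1, Int.fract_eq_self.2 ⟨hx.1, h⟩]
    · simp [G, h0, h1]


/-- rotations -/
def rot (θ : ℝ) : Circle ≃ₜ Circle :=
  circ (OrderIso.addRight θ) (fun x => by simp; ring)

theorem rot_coe (θ x : ℝ) : rot θ (x : Circle) = ((x + θ : ℝ) : Circle) := rfl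

theorem rot_carry {d : ℕ} (θ : ℝ) (v u : List (Fin (d + 1))) (hl : v.length = u.length) (z : ℤ)
    (h : aff u 0 = aff v 0 + θ + z) : Carry (rot θ) v u := by
  intro x _
  rw [rot_coe, coe_eq_iff]
  refine ⟨-z, ?_⟩
  rw [aff_eq v, aff_eq u, h, hl]; push_cast; ring

theorem rot_mem {d : ℕ} (hd : 1 ≤ d) (B : ℤ) :
    rot ((B : ℝ) / ((d : ℝ) + 1) ^ 2) ∈ Tn (d + 1) := by
  refine mem_Tn_of hd (Irr_finite_of (k := 2) fun v hv => ?_) _ (fun x => by simp; ring) (fun x => rfl)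
  obtain ⟨a, ha⟩ := exists_nat_aff v
  obtain ⟨u, hu, z, hz⟩ := word_of_int (d := d) v.length (a + B * (d + 1) ^ (v.length - 2))
  refine ⟨u, rot_carry _ _ _ hu.symm z ?_⟩
  rw [hz, ha]
  obtain ⟨j, hj⟩ := Nat.exists_eq_add_of_le hv
  have hne : (d : ℝ) + 1 ≠ 0 := by positivity
  rw [hj, Nat.add_sub_cancel_left]
  push_cast
  rw [pow_add]
  field_simp
  ring

/-- the infinite comb -/
def U (d : ℕ) (j : ℕ) : List (Fin (d + 1)) :=
  List.replicate (j / d) (Fin.last d) ++ [Fin.ofNat (d + 1) (j % d)]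

theorem U_lt {d j : ℕ} (h : j < d) : U d j = [⟨j, by omega⟩] := by
  simp [U, Nat.div_eq_of_lt h, Nat.mod_eq_of_lt h, Fin.ext_iff]
  omega

theorem U_add {d : ℕ} (hd : 1 ≤ d) (j : ℕ) : U d (j + d) = Fin.last d :: U d j := by
  simp [U, Nat.add_div_right j (by omega : 0 < d), List.replicate_succ]

theorem U_ne_nil (d j : ℕ) : U d j ≠ [] := by simp [U]

theorem U_ge {d : ℕ} (hd : 1 ≤ d) {j : ℕ} (h : d ≤ j) : ∃ w, U d j = Fin.last d :: w := by
  obtain ⟨i, rfl⟩ : ∃ i, j = i + d := ⟨j - d, by omega⟩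
  exact ⟨_, U_add hd i⟩

theorem spine_or {d : ℕ} (hd : 1 ≤ d) (v : List (Fin (d + 1))) :
    (∃ q, v = List.replicate q (Fin.last d)) ∨ ∃ j w, v = U d j ++ w := by
  induction v with
  | nil => exact Or.inl ⟨0, rfl⟩
  | cons k v ih =>
    rcases k.le_last.lt_or_eq with h | rfl
    · right
      have hk : (k : ℕ) < d := h
      exact ⟨k, v, by rw [U_lt hk]; rfl⟩
    · rcases ih with ⟨q, rfl⟩ | ⟨j, w, rfl⟩
      · exact Or.inl ⟨q + 1, by rw [List.replicate_succ]⟩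
      · exact Or.inr ⟨j + d, w, by rw [U_add hd]; rfl⟩

theorem aff_U_adj {d : ℕ} (hd : 1 ≤ d) (j : ℕ) : aff (U d j) 1 = aff (U d (j + 1)) 0 := by
  have hne : (d : ℝ) + 1 ≠ 0 := by positivity
  induction j using Nat.strong_induction_on with
  | _ j ih =>
    rcases lt_or_ge j d with h | h
    · rw [U_lt h]
      rcases lt_or_ge (j + 1) d with h' | h'
      · rw [U_lt h']; simp [aff]
      · obtain rfl : d = j + 1 := by omega
        have := U_add hd 0
        rw [zero_add] at this
        rw [this, U_lt (by omega : 0 < j + 1)]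
        simp [aff]
    · obtain ⟨i, rfl⟩ := Nat.exists_eq_add_of_le h
      rw [show d + i + 1 = (i + 1) + d by ring, add_comm d i, U_add hd, U_add hd]
      simp only [aff]
      rw [ih i (by omega)]

theorem aff_U_strictMono {d : ℕ} (hd : 1 ≤ d) : StrictMono (fun j => aff (U d j) 0) := by
  apply strictMono_nat_of_lt_succ
  intro j
  rw [← aff_U_adj hd, aff_eq _ 1]
  have : (0 : ℝ) < 1 / ((d : ℝ) + 1) ^ (U d j).length := by positivity
  linarith

theorem aff_replicate {d : ℕ} (q : ℕ) (x : ℝ) :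
    aff (List.replicate q (Fin.last d)) x = 1 - (1 - x) / ((d : ℝ) + 1) ^ q := by
  have hne : (d : ℝ) + 1 ≠ 0 := by positivity
  induction q with
  | zero => simp [aff]
  | succ q ih => rw [List.replicate_succ]; simp only [aff, ih, Fin.val_last]; field_simp; ring

theorem U_cover {d : ℕ} (hd : 1 ≤ d) (y : ℝ) (hy : y ∈ Set.Ico (0 : ℝ) 1) :
    ∃ j, ∃ x ∈ Set.Icc (0 : ℝ) 1, aff (U d j) x = y := by
  have hd' : (1 : ℝ) ≤ d := by exact_mod_cast hd
  obtain ⟨q, hq⟩ := exists_pow_lt_of_lt_one (sub_pos.2 hy.2)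
    (by rw [div_lt_one (by positivity)]; linarith : 1 / ((d : ℝ) + 1) < 1)
  obtain ⟨v, hv, x, hx, rfl⟩ := exists_digits (d := d) q y hy
  rcases spine_or hd v with ⟨q', rfl⟩ | ⟨j, w, rfl⟩
  · exfalso
    simp at hv
    subst hv
    rw [aff_replicate, one_div, inv_pow] at hq
    have : (1 - x) / ((d : ℝ) + 1) ^ q' ≤ (((d : ℝ) + 1) ^ q')⁻¹ := by
      rw [div_eq_mul_inv]
      exact mul_le_of_le_one_left (by positivity) (by linarith [hx.1])
    linarith
  · exact ⟨j, aff w x, aff_mem_Icc w ⟨hx.1, hx.2.le⟩, (aff_append _ _ _).symm⟩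

/-- lift of the generators -/
def gf (d p δ : ℝ) (x : ℝ) : ℝ :=
  max x (min (x + d * (x - p)) (min (x + d * ((1 - p - δ) / (d + 1))) (x + d * ((1 - x) / (d + 1)))))

theorem gf_mono {d p δ : ℝ} (hd : 1 ≤ d) : StrictMono (gf d p δ) := by
  have e : ∀ x, x + d * ((1 - x) / (d + 1)) = (x + d) / (d + 1) := by intro x; field_simp; ring
  intro x y h
  unfold gf
  have h0 : 0 < d + 1 := by linarith
  refine max_lt_max h (min_lt_min ?_ (min_lt_min ?_ ?_))
  · nlinarith
  · linarith
  · rw [e, e, div_lt_div_iff_of_pos_right h0]; linarith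

theorem gf_cont {d p δ : ℝ} : Continuous (gf d p δ) := by
  unfold gf; fun_prop

theorem gf1 {d p δ x : ℝ} (hd : 1 ≤ d) (hx : x ≤ p) : gf d p δ x = x := by
  unfold gf
  apply max_eq_left
  apply (min_le_left _ _).trans
  nlinarith

theorem gf2 {d p δ x : ℝ} (hd : 1 ≤ d) (hδ : 1 - p ≤ (d + 2) * δ) (hx : p ≤ x)
    (hx2 : (d + 1) * (x - p) ≤ 1 - p - δ) : gf d p δ x = x + d * (x - p) := by
  have h0 : 0 < d + 1 := by linarith
  have h1 : x - p ≤ (1 - p - δ) / (d + 1) := by rw [le_div_iff₀ h0]; linarith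
  have h2 : x - p ≤ (1 - x) / (d + 1) := by rw [le_div_iff₀ h0]; nlinarith
  unfold gf
  rw [min_eq_left, max_eq_right]
  · nlinarith
  · apply le_min
    · nlinarith
    · nlinarith

theorem gf3 {d p δ x : ℝ} (hd : 1 ≤ d) (hpδ : p + δ ≤ 1)
    (hx : x ≤ p + δ) (hx2 : 1 - p - δ ≤ (d + 1) * (x - p)) :
    gf d p δ x = x + d * ((1 - p - δ) / (d + 1)) := by
  have h0 : 0 < d + 1 := by linarith
  have h1 : (1 - p - δ) / (d + 1) ≤ x - p := by rw [div_le_iff₀ h0]; linarith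
  have h2 : (1 - p - δ) / (d + 1) ≤ (1 - x) / (d + 1) := by
    rw [div_le_div_iff_of_pos_right h0]; linarith
  have h3 : 0 ≤ (1 - p - δ) / (d + 1) := div_nonneg (by linarith) h0.le
  unfold gf
  rw [min_eq_right, min_eq_left, max_eq_right]
  · nlinarith
  · nlinarith
  · apply (min_le_left _ _).trans; nlinarith

theorem gf4 {d p δ x : ℝ} (hd : 1 ≤ d) (hδ : 1 - p ≤ (d + 2) * δ)
    (hx : p + δ ≤ x) (hx1 : x ≤ 1) :
    gf d p δ x = (d + x) / (d + 1) := by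
  have h0 : 0 < d + 1 := by linarith
  have h1 : (1 - x) / (d + 1) ≤ x - p := by rw [div_le_iff₀ h0]; nlinarith
  have h2 : (1 - x) / (d + 1) ≤ (1 - p - δ) / (d + 1) := by
    rw [div_le_div_iff_of_pos_right h0]; linarith
  have h3 : 0 ≤ (1 - x) / (d + 1) := div_nonneg (by linarith) h0.le
  have e : (d + x) / (d + 1) = x + d * ((1 - x) / (d + 1)) := by field_simp; ring
  rw [e]
  unfold gf
  rw [min_eq_right, min_eq_right, max_eq_right]
  · nlinarith
  · nlinarith
  · apply (min_le_right _ _).trans; nlinarith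

theorem exists_gen {d : ℕ} (hd : 1 ≤ d) (i : ℕ) (hi : i ≤ d) : ∃ f ∈ Tn (d + 1),
    (∀ j < i, Carry f (U d j) (U d j)) ∧
    (∀ k : Fin (d + 1), Carry f (U d i ++ [k]) (U d (i + k))) ∧
    (∀ j > i, Carry f (U d j) (U d (j + d))) ∧
    (i < d → Carry f [Fin.last d] [Fin.last d, Fin.last d]) := by
  have hd' : (1 : ℝ) ≤ d := by exact_mod_cast hd
  have h0 : (0 : ℝ) < (d : ℝ) + 1 := by linarith
  have hne := h0.ne'
  have hi' : (i : ℝ) ≤ d := by exact_mod_cast hi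
  have hi0 : (0 : ℝ) ≤ i := by positivity
  obtain ⟨p, hp⟩ : ∃ p : ℝ, p = i / ((d : ℝ) + 1) := ⟨_, rfl⟩
  obtain ⟨δ, hδ⟩ : ∃ δ : ℝ, δ = if i < d then 1 / ((d : ℝ) + 1) else 1 / ((d : ℝ) + 1) ^ 2 := ⟨_, rfl⟩
  have hUi0 : aff (U d i) 0 = p := by
    rcases hi.lt_or_eq with h | rfl
    · rw [U_lt h, hp]; simp [aff]
    · have := U_add hd 0
      rw [zero_add] at this
      rw [this, U_lt (by omega), hp]; simp [aff]
  have hUlen : ((d : ℝ) + 1) ^ (U d i).length = 1 / δ := by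
    rcases hi.lt_or_eq with h | rfl
    · rw [U_lt h, hδ, if_pos h]; simp
    · have := U_add hd 0
      rw [zero_add] at this
      rw [this, U_lt (by omega), hδ, if_neg (lt_irrefl _)]; simp
  have hδ0 : 0 < δ := by rw [hδ]; split_ifs <;> positivity
  have hUi : ∀ x, aff (U d i) x = p + δ * x := by
    intro x; rw [aff_eq, hUi0, hUlen]; field_simp
  have hU1 : aff (U d (i + 1)) 0 = p + δ := by rw [← aff_U_adj hd, hUi]; ring
  have hp0 : 0 ≤ p := by rw [hp]; positivity
  have hpδ1 : p + δ ≤ 1 := by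
    rw [← hU1]; exact (aff_mem_Icc _ (by norm_num)).2
  have hcond : 1 - p ≤ ((d : ℝ) + 2) * δ := by
    rw [hp, hδ]
    split_ifs with h
    · field_simp; linarith
    · obtain rfl : i = d := by omega
      field_simp; nlinarith
  have hF0 : gf d p δ 0 = 0 := gf1 hd' hp0
  have hF1 : gf d p δ 1 = 1 := by rw [gf4 hd' hcond hpδ1 le_rfl]; field_simp
  obtain ⟨E, hE, hEF⟩ := exists_extend (gf d p δ) hF0 hF1 ((gf_mono hd').strictMonoOn _) (by
    intro y hy
    have := intermediate_value_Icc (zero_le_one (α := ℝ)) (gf_cont (d := d) (p := p) (δ := δ)).continuousOn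
    rw [hF0, hF1] at this
    obtain ⟨x, hx, rfl⟩ := this ⟨hy.1, hy.2.le⟩
    refine ⟨x, ⟨hx.1, hx.2.lt_of_ne ?_⟩, rfl⟩
    rintro rfl
    rw [hF1] at hy; exact lt_irrefl _ hy.2)
  have carry : ∀ v u : List (Fin (d + 1)), (∀ x ∈ Set.Icc (0 : ℝ) 1, gf d p δ (aff v x) = aff u x) →
      Carry (circ E hE) v u := by
    intro v u h x hx
    rw [circ_coe, hEF _ (aff_mem_Icc v hx), h x hx]
  have mono0 : ∀ (v : List (Fin (d + 1))) (x : ℝ), 0 ≤ x → aff v 0 ≤ aff v x := by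
    intro v x hx
    rw [aff_eq v x]
    have : 0 ≤ x / ((d : ℝ) + 1) ^ v.length := by positivity
    linarith
  have mono1 : ∀ (v : List (Fin (d + 1))) (x : ℝ), x ≤ 1 → aff v x ≤ aff v 1 := by
    intro v x hx
    rw [aff_eq v x, aff_eq v 1]
    have : x / ((d : ℝ) + 1) ^ v.length ≤ 1 / ((d : ℝ) + 1) ^ v.length := by gcongr
    linarith
  have c1 : ∀ j < i, Carry (circ E hE) (U d j) (U d j) := by
    intro j hj
    apply carry
    intro x hx
    apply gf1 hd'
    apply (mono1 _ _ hx.2).trans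
    rw [aff_U_adj hd, ← hUi0]
    exact (aff_U_strictMono hd).monotone hj
  have c3' : ∀ v : List (Fin (d + 1)), p + δ ≤ aff v 0 → Carry (circ E hE) v (Fin.last d :: v) := by
    intro v hv
    apply carry
    intro x hx
    rw [gf4 hd' hcond (hv.trans (mono0 _ _ hx.1)) (aff_mem_Icc v hx).2]
    simp [aff]
  have c3 : ∀ j > i, Carry (circ E hE) (U d j) (U d (j + d)) := by
    intro j hj
    rw [U_add hd]
    apply c3'
    rw [← hU1]
    exact (aff_U_strictMono hd).monotone hj
  have c2 : ∀ k : Fin (d + 1), Carry (circ E hE) (U d i ++ [k]) (U d (i + k)) := by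
    intro k
    apply carry
    intro x hx
    have hx0 := hx.1
    have hx1 := hx.2
    have hk := fin_cast_le k
    have hk0 : (0 : ℝ) ≤ (k : ℕ) := by positivity
    rw [aff_append, hUi]
    simp only [aff]
    rcases hi.lt_or_eq with h | rfl
    · rw [if_pos h] at hδ
      rcases lt_or_ge (i + k : ℕ) d with h2 | h2
      · have h2' : (i : ℝ) + (k : ℕ) + 1 ≤ d := by exact_mod_cast h2
        rw [U_lt h2, gf2 hd' hcond]
        · simp only [aff]; rw [hp, hδ]; push_cast; field_simp; ring
        · have : 0 ≤ δ * (((k : ℕ) + x) / ((d : ℝ) + 1)) := by positivity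
          linarith
        · rw [hp, hδ]; field_simp; nlinarith
      · obtain ⟨r, hr⟩ := Nat.exists_eq_add_of_le h2
        have hrd : r < d := by have := k.2; omega
        have hr' : (i : ℝ) + (k : ℕ) = d + r := by exact_mod_cast hr
        have hr'' : ((k : ℕ) : ℝ) = d + r - i := by linarith
        have hr0 : (0 : ℝ) ≤ r := by positivity
        rw [hr, add_comm d r, U_add hd, U_lt hrd, gf3 hd' hpδ1]
        · simp only [aff, Fin.val_last]; rw [hp, hδ, hr'']; field_simp; ring
        · have : ((k : ℕ) + x) / ((d : ℝ) + 1) ≤ 1 := by rw [div_le_one h0]; linarith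
          nlinarith
        · rw [hp, hδ]; field_simp; nlinarith
    · rw [if_neg (lt_irrefl _)] at hδ
      rcases lt_or_ge (k : ℕ) i with h2 | h2
      · have h2' : ((k : ℕ) : ℝ) + 1 ≤ i := by exact_mod_cast h2
        rw [Nat.add_comm i (k : ℕ), U_add hd, U_lt h2, gf2 hd' hcond]
        · simp only [aff, Fin.val_last]; rw [hp, hδ]; field_simp; ring
        · have : 0 ≤ δ * (((k : ℕ) + x) / ((i : ℝ) + 1)) := by positivity
          linarith
        · rw [hp, hδ]; field_simp; nlinarith
      · have hki : (k : ℕ) = 0 + i := by have := k.2; omega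
        rw [hki, Nat.add_comm i (0 + i), U_add hd, U_add hd, U_lt (by omega), gf3 hd' hpδ1]
        · simp only [aff, Fin.val_last]; rw [hp, hδ]; push_cast; field_simp; ring
        · have : ((0 + i : ℕ) + x) / ((i : ℝ) + 1) ≤ 1 := by
            rw [div_le_one h0]; push_cast; linarith
          nlinarith
        · rw [hp, hδ]; push_cast; field_simp; nlinarith
  have c4 : i < d → Carry (circ E hE) [Fin.last d] [Fin.last d, Fin.last d] := by
    intro h
    apply c3'
    have : (i : ℝ) + 1 ≤ d := by exact_mod_cast h
    rw [hp, hδ, if_pos h]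
    simp only [aff, Fin.val_last]
    rw [← add_div, add_zero, div_le_div_iff_of_pos_right h0]
    linarith
  refine ⟨circ E hE, mem_Tn_of hd (Irr_finite_of (k := 3) fun v hv => ?_) E hE (fun x => rfl), c1, c2, c3, c4⟩
  rcases spine_or hd v with ⟨q, rfl⟩ | ⟨j, w, rfl⟩
  · refine ⟨_, c3' _ ?_⟩
    simp at hv
    have h1 : 1 / ((d : ℝ) + 1) ^ q ≤ 1 / ((d : ℝ) + 1) ^ 2 :=
      one_div_le_one_div_of_le (by positivity) (pow_le_pow_right₀ (by linarith) (by omega))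
    rw [aff_replicate, sub_zero]
    refine le_trans ?_ (sub_le_sub_left h1 1)
    rw [hp, hδ]
    split_ifs with h
    · have : (i : ℝ) + 1 ≤ d := by exact_mod_cast h
      field_simp; nlinarith
    · obtain rfl : i = d := by omega
      field_simp; nlinarith
  · rcases lt_trichotomy j i with h | rfl | h
    · exact ⟨_, (c1 j h).append w⟩
    · cases w with
      | nil =>
        exfalso
        rcases hi.lt_or_eq with h | rfl
        · rw [U_lt h] at hv; simp at hv
        · have := U_add hd 0
          rw [zero_add] at this
          rw [this, U_lt (by omega)] at hv; simp at hv
      | cons k w => exact ⟨_, by simpa using (c2 k).append w⟩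
    · exact ⟨_, (c3 j h).append w⟩


/-- length functions -/
structure IsLen {G : Type*} [Group G] (ℓ : G → ℕ) : Prop where
  one : ℓ 1 = 0
  mul : ∀ g h, ℓ (g * h) ≤ ℓ g + ℓ h
  inv : ∀ g, ℓ g⁻¹ = ℓ g

theorem exists_word {G : Type*} [Group G] (S : Set G) (hS : Subgroup.closure S = ⊤) (g : G) :
    ∃ w : List G, w.length = wordLength S g ∧ (∀ x ∈ w, x ∈ S ∨ x⁻¹ ∈ S) ∧ w.prod = g := by
  have : (wordLength S g) ∈ { k : ℕ | ∃ w : List G, w.length = k ∧ (∀ x ∈ w, x ∈ S ∨ x⁻¹ ∈ S) ∧ w.prod = g } := by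
    apply Nat.sInf_mem
    have hg : g ∈ Subgroup.closure S := hS ▸ Subgroup.mem_top g
    rw [← Subgroup.mem_toSubmonoid, Subgroup.closure_toSubmonoid] at hg
    obtain ⟨w, h1, h2⟩ := Submonoid.exists_list_of_mem_closure hg
    exact ⟨_, w, rfl, fun x hx => by simpa using h1 x hx, h2⟩
  exact this

theorem wordLength_le {G : Type*} [Group G] (S : Set G) (w : List G)
    (h : ∀ x ∈ w, x ∈ S ∨ x⁻¹ ∈ S) : wordLength S w.prod ≤ w.length :=
  Nat.sInf_le ⟨w, rfl, h, rfl⟩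

theorem isLen_wordLength {G : Type*} [Group G] (S : Set G) (hS : Subgroup.closure S = ⊤) :
    IsLen (wordLength S) := by
  have hinv : ∀ g, wordLength S g⁻¹ ≤ wordLength S g := by
    intro g
    obtain ⟨w, h1, h2, h3⟩ := exists_word S hS g
    rw [← h1, ← h3, List.prod_inv_reverse]
    refine (wordLength_le S _ ?_).trans (by simp)
    intro x hx
    simp at hx
    have := h2 _ hx
    simpa [or_comm] using this
  refine ⟨?_, ?_, ?_⟩
  · have := wordLength_le S [] (by simp)
    simpa using this
  · intro g h
    obtain ⟨w, h1, h2, h3⟩ := exists_word S hS g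
    obtain ⟨w', h1', h2', h3'⟩ := exists_word S hS h
    have := wordLength_le S (w ++ w') (by
      intro x hx
      rcases List.mem_append.1 hx with hx | hx
      · exact h2 x hx
      · exact h2' x hx)
    simpa [h3, h3', h1, h1'] using this
  · intro g
    refine le_antisymm (hinv g) ?_
    simpa using hinv g⁻¹

theorem IsLen.le_wordLength {G : Type*} [Group G] {κ : G → ℕ} (hκ : IsLen κ) (S : Finset G)
    (hS : Subgroup.closure (S : Set G) = ⊤) : ∃ C, ∀ g, κ g ≤ C * wordLength (S : Set G) g := by
  refine ⟨S.sup κ, fun g => ?_⟩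
  obtain ⟨w, h1, h2, h3⟩ := exists_word (S : Set G) hS g
  rw [← h1, ← h3]
  clear h1 h3
  induction w with
  | nil => simp [hκ.one]
  | cons a w ih =>
    rw [List.prod_cons, List.length_cons]
    have ha : κ a ≤ S.sup κ := by
      rcases h2 a (by simp) with h | h
      · exact Finset.le_sup (f := κ) (by simpa using h)
      · rw [← hκ.inv]; exact Finset.le_sup (f := κ) (by simpa using h)
    have := hκ.mul a w.prod
    have := ih (fun x hx => h2 x (by simp [hx]))
    rw [mul_add, mul_one]; omega

theorem IsLen.comp {G H : Type*} [Group G] [Group H] {κ : H → ℕ} (hκ : IsLen κ) (φ : G →* H) :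
    IsLen (fun g => κ (φ g)) :=
  ⟨by simp [hκ.one], fun g h => by simp [hκ.mul], fun g => by simp [hκ.inv]⟩

theorem IsLen.add {G : Type*} [Group G] {κ κ' : G → ℕ} (hκ : IsLen κ) (hκ' : IsLen κ') :
    IsLen (fun g => κ g + κ' g) :=
  ⟨by simp [hκ.one, hκ'.one], fun g h => by have := hκ.mul g h; have := hκ'.mul g h; omega,
    fun g => by simp [hκ.inv, hκ'.inv]⟩

/-- number of carets -/
def K2 (d : ℕ) (g : Tn (d + 1)) : ℕ :=
  (Irr d (g : Circle ≃ₜ Circle)).ncard + (Irr d (g : Circle ≃ₜ Circle)⁻¹).ncard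

theorem isLen_K2 {d : ℕ} (hd : 1 ≤ d) : IsLen (K2 d) := by
  refine ⟨?_, ?_, ?_⟩
  · simp [K2, Irr_one]
  · intro g h
    have f1 := Irr_finite_of_mem hd g.2
    have f2 := Irr_finite_of_mem hd h.2
    have a := (Irr_mul_aux hd _ _ f1 f2).2
    have b := (Irr_mul_aux hd _ _ (Irr_inv_finite f2) (Irr_inv_finite f1)).2
    simp only [K2, Subgroup.coe_mul, mul_inv_rev]
    omega
  · intro g
    simp [K2, add_comm]


/-- minimal words outside `E` -/
def Leaf {α : Type*} (E : Finset (List α)) (p : List α) : Prop :=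
  p ∉ E ∧ ∀ q s, p = q ++ s → s ≠ [] → q ∈ E

/-- branch of `E` below `k` -/
def sub {α : Type*} (E : Finset (List α)) (k : α) : Finset (List α) :=
  E.preimage (fun p => k :: p) (fun a _ b _ h => by simpa using h)

theorem mem_sub {α : Type*} {E : Finset (List α)} {k : α} {p : List α} :
    p ∈ sub E k ↔ k :: p ∈ E := Finset.mem_preimage

theorem leaf_nil {α : Type*} {E : Finset (List α)} (h : [] ∉ E) {p : List α} :
    Leaf E p ↔ p = [] := by
  constructor
  · rintro ⟨_, h2⟩
    by_contra hp
    exact h (h2 [] p rfl hp)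
  · rintro rfl
    refine ⟨h, fun q s e hs => ?_⟩
    simp at e; exact absurd e.2 hs

theorem leaf_node {α : Type*} {E : Finset (List α)} (h : [] ∈ E) {p : List α} :
    Leaf E p ↔ ∃ k p', p = k :: p' ∧ Leaf (sub E k) p' := by
  constructor
  · rintro ⟨h1, h2⟩
    cases p with
    | nil => exact absurd h h1
    | cons k p =>
      refine ⟨k, p, rfl, by rwa [mem_sub], fun q s e hs => ?_⟩
      rw [mem_sub]
      exact h2 (k :: q) s (by simp [e]) hs
  · rintro ⟨k, p, rfl, h1, h2⟩
    refine ⟨by rwa [mem_sub] at h1, fun q s e hs => ?_⟩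
    cases q with
    | nil => exact h
    | cons k' q =>
      simp at e
      obtain ⟨rfl, e⟩ := e
      have := h2 q s e hs
      rwa [mem_sub] at this

theorem sum_sub {d : ℕ} (E : Finset (List (Fin (d + 1)))) :
    ∑ k, (sub E k).card ≤ (E.erase []).card := by
  classical
  rw [← Finset.card_sigma]
  refine Finset.card_le_card_of_injOn (fun x => x.1 :: x.2) ?_ ?_
  · rintro ⟨k, p⟩ hx
    simp [mem_sub] at hx ⊢
    exact hx
  · rintro ⟨k, p⟩ _ ⟨k', p'⟩ _ h
    simp at h
    obtain ⟨rfl, rfl⟩ := h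
    rfl

/-- leaves of a forest hung on the comb from index `i` -/
def Lv (d i : ℕ) (L : List (Finset (List (Fin (d + 1))))) (v : List (Fin (d + 1))) : Prop :=
  ∃ k p, v = U d (i + k) ++ p ∧ Leaf (L.getD k ∅) p

/-- `W` carries the forest to the comb -/
def Comb (d i : ℕ) (W : Circle ≃ₜ Circle) (L : List (Finset (List (Fin (d + 1))))) : Prop :=
  (∀ j < i, Carry W (U d j) (U d j)) ∧
  (∀ v, Lv d i L v → ∃ j, i ≤ j ∧ Carry W v (U d j)) ∧
  (∀ j, i ≤ j → ∃ v, Lv d i L v ∧ Carry W v (U d j))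

theorem comb_nil (d i : ℕ) : Comb d i 1 [] := by
  refine ⟨fun j _ => Carry.one _, ?_, ?_⟩
  · rintro v ⟨k, p, rfl, h⟩
    rw [List.getD_nil, leaf_nil (by simp)] at h
    subst h
    exact ⟨i + k, by omega, by simpa using Carry.one _⟩
  · intro j hj
    obtain ⟨k, rfl⟩ := Nat.exists_eq_add_of_le hj
    exact ⟨U d (i + k), ⟨k, [], by simp, by simp [leaf_nil]⟩, Carry.one _⟩

theorem comb_leaf {d i : ℕ} {W : Circle ≃ₜ Circle} {E} {L} (hE : [] ∉ E) (h : Comb d (i + 1) W L) :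
    Comb d i W (E :: L) := by
  obtain ⟨h1, h2, h3⟩ := h
  refine ⟨fun j hj => h1 j (by omega), ?_, ?_⟩
  · rintro v ⟨k, p, rfl, hp⟩
    cases k with
    | zero =>
      rw [List.getD_cons_zero, leaf_nil hE] at hp
      subst hp
      exact ⟨i, le_rfl, by simpa using h1 i (by omega)⟩
    | succ k =>
      rw [List.getD_cons_succ] at hp
      obtain ⟨j, hj, hc⟩ := h2 (U d (i + (k + 1)) ++ p) ⟨k, p, by rw [show i + 1 + k = i + (k + 1) by ring], hp⟩
      exact ⟨j, by omega, hc⟩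
  · intro j hj
    rcases hj.eq_or_lt with rfl | hj
    · exact ⟨U d i, ⟨0, [], by simp, by simp [leaf_nil hE]⟩, h1 i (by omega)⟩
    · obtain ⟨v, ⟨k, p, rfl, hp⟩, hc⟩ := h3 j hj
      exact ⟨_, ⟨k + 1, p, by rw [show i + 1 + k = i + (k + 1) by ring], by simpa using hp⟩, hc⟩

theorem comb_shift {d : ℕ} {W a : Circle ≃ₜ Circle} {L}
    (ha2 : ∀ k : Fin (d + 1), Carry a (U d 0 ++ [k]) (U d (0 + k)))
    (ha3 : ∀ j > 0, Carry a (U d j) (U d (j + d))) (h : Comb d 1 W L) :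
    Comb d (d + 1) (a * W * a⁻¹) L := by
  obtain ⟨h1, h2, h3⟩ := h
  refine ⟨fun j hj => ?_, ?_, ?_⟩
  · have := ha2 ⟨j, hj⟩
    simp only [zero_add] at this
    exact (this.comp ((h1 0 (by omega)).append _)).comp this.inv
  · rintro v ⟨k, p, rfl, hp⟩
    obtain ⟨j, hj, hc⟩ := h2 _ ⟨k, p, rfl, hp⟩
    refine ⟨j + d, by omega, ((ha3 j (by omega)).comp hc).comp ?_⟩
    have := ((ha3 (1 + k) (by omega)).append p).inv
    rwa [show 1 + k + d = d + 1 + k by ring] at this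
  · intro j hj
    obtain ⟨v, ⟨k, p, rfl, hp⟩, hc⟩ := h3 (j - d) (by omega)
    refine ⟨_, ⟨k, p, rfl, hp⟩, ?_⟩
    have e := ha3 (j - d) (by omega)
    rw [show j - d + d = j by omega] at e
    refine (e.comp hc).comp ?_
    have := ((ha3 (1 + k) (by omega)).append p).inv
    rwa [show 1 + k + d = d + 1 + k by ring] at this

theorem getD_lt {d : ℕ} (E : Finset (List (Fin (d + 1)))) (L) (k : Fin (d + 1)) :
    (List.ofFn (sub E) ++ L).getD k ∅ = sub E k := by
  rw [List.getD_append _ _ _ _ (by rw [List.length_ofFn]; exact k.2), List.getD_eq_getElem _ _ (by rw [List.length_ofFn]; exact k.2),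
    List.getElem_ofFn]

theorem getD_ge {d : ℕ} (E : Finset (List (Fin (d + 1)))) (L) (k : ℕ) :
    (List.ofFn (sub E) ++ L).getD (k + 1 + d) ∅ = L.getD k ∅ := by
  rw [List.getD_append_right _ _ _ _ (by rw [List.length_ofFn]; omega)]
  congr 1
  rw [List.length_ofFn]; omega

theorem comb_node {d i : ℕ} {W a : Circle ≃ₜ Circle} {E} {L} (hE : [] ∈ E)
    (ha1 : ∀ j < i, Carry a (U d j) (U d j))
    (ha2 : ∀ k : Fin (d + 1), Carry a (U d i ++ [k]) (U d (i + k)))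
    (ha3 : ∀ j > i, Carry a (U d j) (U d (j + d)))
    (h : Comb d i W (List.ofFn (sub E) ++ L)) : Comb d i (W * a) (E :: L) := by
  obtain ⟨h1, h2, h3⟩ := h
  refine ⟨fun j hj => (h1 j hj).comp (ha1 j hj), ?_, ?_⟩
  · rintro v ⟨k, p, rfl, hp⟩
    cases k with
    | zero =>
      rw [List.getD_cons_zero, leaf_node hE] at hp
      obtain ⟨c, p, rfl, hp⟩ := hp
      obtain ⟨j, hj, hc⟩ := h2 (U d (i + c) ++ p) ⟨c, p, rfl, by rwa [getD_lt]⟩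
      refine ⟨j, hj, hc.comp ?_⟩
      simpa using (ha2 c).append p
    | succ k =>
      rw [List.getD_cons_succ] at hp
      obtain ⟨j, hj, hc⟩ := h2 (U d (i + (k + 1) + d) ++ p)
        ⟨k + 1 + d, p, by rw [add_assoc], by rwa [getD_ge]⟩
      exact ⟨j, hj, hc.comp ((ha3 _ (by omega)).append p)⟩
  · intro j hj
    obtain ⟨v, ⟨k, p, rfl, hp⟩, hc⟩ := h3 j hj
    rcases lt_or_ge k (d + 1) with hk | hk
    · have e := getD_lt E L ⟨k, hk⟩
      simp only at e
      rw [e] at hp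
      refine ⟨U d i ++ (⟨k, hk⟩ :: p), ⟨0, _, rfl, ?_⟩, hc.comp ?_⟩
      · rw [List.getD_cons_zero, leaf_node hE]; exact ⟨_, _, rfl, hp⟩
      · simpa using (ha2 ⟨k, hk⟩).append p
    · obtain ⟨k, rfl⟩ : ∃ k', k = k' + 1 + d := ⟨k - 1 - d, by omega⟩
      rw [getD_ge] at hp
      refine ⟨U d (i + (k + 1)) ++ p, ⟨k + 1, p, rfl, by simpa using hp⟩, hc.comp ?_⟩
      have := (ha3 (i + (k + 1)) (by omega)).append p
      rwa [add_assoc] at this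

/-- weight of a forest -/
def fw (d : ℕ) (L : List (Finset (List (Fin (d + 1))))) : ℕ :=
  (2 * d + 1) * (L.map Finset.card).sum + 2 * L.length

theorem fw_cons (d : ℕ) (E L) : fw d (E :: L) = fw d L + (2 * d + 1) * E.card + 2 := by
  simp [fw]; ring

theorem fw_node {d : ℕ} {E : Finset (List (Fin (d + 1)))} (hE : [] ∈ E) (L) :
    fw d (List.ofFn (sub E) ++ L) + 1 ≤ fw d (E :: L) := by
  have h := sum_sub E
  rw [Finset.card_erase_of_mem hE] at h
  have hpos : 0 < E.card := Finset.card_pos.2 ⟨_, hE⟩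
  obtain ⟨c, hc⟩ : ∃ c, E.card = c + 1 := ⟨E.card - 1, by omega⟩
  rw [fw_cons]
  have e : ((List.ofFn (sub E)).map Finset.card).sum = ∑ k, (sub E k).card := by
    rw [List.map_ofFn, List.sum_ofFn]; rfl
  simp only [fw, List.map_append, List.sum_append, List.length_append, List.length_ofFn, e]
  rw [hc] at h ⊢
  have : (2 * d + 1) * ∑ k, (sub E k).card ≤ (2 * d + 1) * c := Nat.mul_le_mul_left _ (by omega)
  nlinarith

theorem comb_exists {d : ℕ} (hd : 1 ≤ d) {ℓ : Tn (d + 1) → ℕ} (hℓ : IsLen ℓ) :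
    ∃ C, ∀ (L : List (Finset (List (Fin (d + 1))))), ∃ W : Tn (d + 1),
      ℓ W ≤ C * fw d L ∧ Comb d 0 W L := by
  have gen : ∀ i : Fin (d + 1), ∃ f : Tn (d + 1),
    (∀ j < (i : ℕ), Carry (f : Circle ≃ₜ Circle) (U d j) (U d j)) ∧
    (∀ k : Fin (d + 1), Carry (f : Circle ≃ₜ Circle) (U d i ++ [k]) (U d (i + k))) ∧
    (∀ j > (i : ℕ), Carry (f : Circle ≃ₜ Circle) (U d j) (U d (j + d))) := by
    intro i
    obtain ⟨f, hf, h1, h2, h3, _⟩ := exists_gen hd i (by omega)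
    exact ⟨⟨f, hf⟩, h1, h2, h3⟩
  choose a ha1 ha2 ha3 using gen
  obtain ⟨C, hC⟩ : ∃ C, ∀ i, ℓ (a i) ≤ C :=
    ⟨Finset.univ.sup (fun i => ℓ (a i)), fun i => Finset.le_sup (f := fun i => ℓ (a i)) (Finset.mem_univ i)⟩
  refine ⟨C, fun L => ?_⟩
  suffices H : ∀ N (L : List (Finset (List (Fin (d + 1))))), fw d L ≤ N → ∀ i : Fin (d + 1),
      ∃ W : Tn (d + 1), ℓ W ≤ C * fw d L ∧ Comb d i W L from H _ L le_rfl 0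
  intro N
  induction N with
  | zero =>
    intro L hL i
    have : L = [] := by
      cases L with
      | nil => rfl
      | cons E L => rw [fw_cons] at hL; omega
    subst this
    exact ⟨1, by simp [hℓ.one], comb_nil d i⟩
  | succ N ih =>
    intro L hL i
    cases L with
    | nil => exact ⟨1, by simp [hℓ.one], comb_nil d i⟩
    | cons E L =>
      by_cases hE : [] ∈ E
      · have hn := fw_node hE L
        obtain ⟨W, hW, hc⟩ := ih (List.ofFn (sub E) ++ L) (by omega) i
        refine ⟨W * a i, ?_, ?_⟩
        · calc ℓ (W * a i) ≤ ℓ W + ℓ (a i) := hℓ.mul _ _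
            _ ≤ C * fw d (List.ofFn (sub E) ++ L) + C := add_le_add hW (hC i)
            _ = C * (fw d (List.ofFn (sub E) ++ L) + 1) := by ring
            _ ≤ _ := Nat.mul_le_mul_left _ hn
        · exact comb_node hE (ha1 i) (ha2 i) (ha3 i) hc
      · have hn := fw_cons d E L
        rcases Nat.lt_or_ge i d with hi | hi
        · obtain ⟨W, hW, hc⟩ := ih L (by omega) ⟨i + 1, by omega⟩
          exact ⟨W, hW.trans (Nat.mul_le_mul_left _ (by omega)), comb_leaf hE hc⟩
        · obtain ⟨W, hW, hc⟩ := ih L (by omega) ⟨1, by omega⟩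
          refine ⟨a 0 * W * (a 0)⁻¹, ?_, ?_⟩
          · have e1 := hℓ.mul (a 0 * W) (a 0)⁻¹
            have e2 := hℓ.mul (a 0) W
            have e3 := hC 0
            rw [hℓ.inv] at e1
            calc _ ≤ C * fw d L + 2 * C := by omega
              _ = C * (fw d L + 2) := by ring
              _ ≤ _ := Nat.mul_le_mul_left _ (by omega)
          · have hid : (i : ℕ) = d := by have := i.2; omega
            rw [hid]
            exact comb_leaf hE (comb_shift (by simpa using ha2 0) (by simpa using ha3 0) hc)

theorem U_inj {d : ℕ} (hd : 1 ≤ d) {j j' : ℕ} (h : U d j = U d j') : j = j' :=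
  (aff_U_strictMono hd).injective (by simp [h])

theorem comb_id {d : ℕ} (hd : 1 ≤ d) {e : Circle ≃ₜ Circle}
    (h1 : ∀ j, ∃ j', Carry e (U d j) (U d j')) (h2 : ∀ j, ∃ j', Carry e⁻¹ (U d j) (U d j')) :
    e = 1 := by
  choose σ hσ using h1
  have hs : ∀ j, σ (j + 1) = σ j + 1 := by
    intro j
    apply (aff_U_strictMono hd).injective
    have a1 := hσ j 1 (by norm_num)
    have a2 := hσ (j + 1) 0 (by norm_num)
    rw [aff_U_adj hd, aff_U_adj hd] at a1
    exact coe_inj_Ico (aff_mem_Ico _ (by norm_num)) (aff_mem_Ico _ (by norm_num)) (a2.symm.trans a1)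
  have hs' : ∀ j, σ j = σ 0 + j := by
    intro j
    induction j with
    | zero => rfl
    | succ j ih => rw [hs, ih]; ring
  obtain ⟨j', hj'⟩ := h2 0
  have h0 := U_inj hd (Carry.unique hd (hσ j') (by simpa using hj'.inv))
  have hid : ∀ j, σ j = j := fun j => by have := hs' j; have := hs' j'; omega
  ext p
  obtain ⟨x, hx, rfl⟩ := exists_rep p
  obtain ⟨j, y, hy, rfl⟩ := U_cover hd x hx
  rw [hσ j y hy, hid, hone_apply]

theorem leaf_transfer {d : ℕ} (hd : 1 ≤ d) {g : Circle ≃ₜ Circle}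
    {P Q : Finset (List (Fin (d + 1)))} (hP : ∀ v, v ∈ P ↔ v ∈ Irr d g)
    (hQ : ∀ v, v ∈ Q ↔ v ∈ Irr d g⁻¹) (hg : Carry g [Fin.last d] [Fin.last d])
    {v} (hv : Lv d 0 (List.ofFn fun j : Fin d => sub P j.castSucc) v) :
    ∃ u, Carry g v u ∧ Lv d 0 (List.ofFn fun j : Fin d => sub Q j.castSucc) u := by
  have big : ∀ (P : Finset (List (Fin (d + 1)))) (k : ℕ), d ≤ k →
      (List.ofFn fun j : Fin d => sub P j.castSucc).getD k ∅ = ∅ := by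
    intro P k hk
    rw [List.getD_eq_default]; simpa using hk
  have small : ∀ (P : Finset (List (Fin (d + 1)))) (k : Fin d),
      (List.ofFn fun j : Fin d => sub P j.castSucc).getD k ∅ = sub P k.castSucc := by
    intro P k
    simp [List.getD_eq_getElem?_getD]
  obtain ⟨k, p, rfl, hp⟩ := hv
  rw [zero_add]
  rcases Nat.lt_or_ge k d with hk | hk
  · have e := small P ⟨k, hk⟩
    simp only at e
    rw [e] at hp
    rw [U_lt hk]
    set k' : Fin (d + 1) := ⟨k, by omega⟩ with hk'
    have hkk : (⟨k, hk⟩ : Fin d).castSucc = k' := rfl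
    rw [hkk] at hp
    obtain ⟨hp1, hp2⟩ := hp
    rw [mem_sub, hP] at hp1
    simp only [Irr, Set.mem_setOf_eq, not_not] at hp1
    obtain ⟨u, hu⟩ := hp1
    refine ⟨u, hu, ?_⟩
    cases u with
    | nil => have := hu.nil_right hd; simp at this
    | cons c p' =>
      have hc : c ≠ Fin.last d := by
        rintro rfl
        have h1 := hg.append p'
        have := Carry.unique_left hd hu h1
        simp at this
        have := congrArg Fin.val this.1
        simp [hk'] at this
        omega
      have hcd : (c : ℕ) < d := by
        have := c.le_last.lt_of_ne hc; exact this
      refine ⟨c, p', by rw [zero_add, U_lt hcd]; rfl, ?_⟩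
      have e := small Q ⟨c, hcd⟩
      simp only at e
      rw [e]
      have hcc : (⟨c, hcd⟩ : Fin d).castSucc = c := rfl
      rw [hcc]
      refine ⟨?_, ?_⟩
      · rw [mem_sub, hQ]
        simp only [Irr, Set.mem_setOf_eq, not_not]
        exact ⟨_, hu.inv⟩
      · intro q s hqs hs
        rw [mem_sub, hQ]
        rintro ⟨w, hw⟩
        have h1 := hw.append s
        have h2 := Carry.unique hd hu.inv (by simpa [hqs] using h1)
        cases w with
        | nil => have := hw.nil_right hd; simp at this
        | cons k2 q2 =>
          simp at h2
          obtain ⟨rfl, h2⟩ := h2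
          have := hp2 q2 s h2 hs
          rw [mem_sub, hP] at this
          exact this ⟨_, by simpa using hw.inv⟩
  · rw [big P k hk, leaf_nil (by simp)] at hp
    subst hp
    rw [List.append_nil]
    refine ⟨U d k, ?_, k, [], by simp, by rw [big Q k hk, leaf_nil (by simp)]⟩
    obtain ⟨w, hw⟩ := U_ge hd hk
    rw [hw]
    exact hg.append w

theorem stepC {d : ℕ} (hd : 1 ≤ d) {ℓ : Tn (d + 1) → ℕ} (hℓ : IsLen ℓ) :
    ∃ C, ∀ g : Tn (d + 1), Carry (g : Circle ≃ₜ Circle) [Fin.last d] [Fin.last d] →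
      ℓ g ≤ C * K2 d g + C := by
  obtain ⟨C, hC⟩ := comb_exists hd hℓ
  have key : ∀ (g : Circle ≃ₜ Circle) (P Q : Finset (List (Fin (d + 1)))) (W V : Circle ≃ₜ Circle)
      (hP : ∀ v, v ∈ P ↔ v ∈ Irr d g) (hQ : ∀ v, v ∈ Q ↔ v ∈ Irr d g⁻¹)
      (hg : Carry g [Fin.last d] [Fin.last d])
      (hW : Comb d 0 W (List.ofFn fun j : Fin d => sub P j.castSucc))
      (hV : Comb d 0 V (List.ofFn fun j : Fin d => sub Q j.castSucc)),
      ∀ j, ∃ j', Carry (V * g * W⁻¹) (U d j) (U d j') := by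
    intro g P Q W V hP hQ hg hW hV j
    obtain ⟨v, hv, hvc⟩ := hW.2.2 j (by omega)
    obtain ⟨u, hu, huL⟩ := leaf_transfer hd hP hQ hg hv
    obtain ⟨j', _, hj'⟩ := hV.2.1 u huL
    exact ⟨j', (hj'.comp hu).comp hvc.inv⟩
  have wt : ∀ P : Finset (List (Fin (d + 1))),
      fw d (List.ofFn fun j : Fin d => sub P j.castSucc) ≤ (2 * d + 1) * P.card + 2 * d := by
    intro P
    have h := (sum_sub P).trans (Finset.card_le_card (Finset.erase_subset _ _))
    rw [Fin.sum_univ_castSucc] at h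
    have e : ((List.ofFn fun j : Fin d => sub P j.castSucc).map Finset.card).sum
        = ∑ k : Fin d, (sub P k.castSucc).card := by
      rw [List.map_ofFn, List.sum_ofFn]; rfl
    simp only [fw, e, List.length_ofFn]
    have : (2 * d + 1) * ∑ k : Fin d, (sub P k.castSucc).card ≤ (2 * d + 1) * P.card :=
      Nat.mul_le_mul_left _ (by omega)
    omega
  refine ⟨C * (4 * d + 1), fun g hg => ?_⟩
  have f1 := Irr_finite_of_mem hd g.2
  have f2 := Irr_inv_finite f1
  obtain ⟨W, hW, hWc⟩ := hC (List.ofFn fun j : Fin d => sub f1.toFinset j.castSucc)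
  obtain ⟨V, hV, hVc⟩ := hC (List.ofFn fun j : Fin d => sub f2.toFinset j.castSucc)
  have k1 := key g f1.toFinset f2.toFinset W V (by simp) (by simp) hg hWc hVc
  have k2 := key (g : Circle ≃ₜ Circle)⁻¹ f2.toFinset f1.toFinset V W (by simp) (by simp) hg.inv hVc hWc
  have hid := comb_id hd k1 (by
    intro j
    obtain ⟨j', h⟩ := k2 j
    refine ⟨j', ?_⟩
    simpa [mul_assoc] using h)
  have hg' : g = V⁻¹ * W := by
    have : V * g * W⁻¹ = 1 := Subtype.ext (by simpa using hid)
    rw [mul_inv_eq_one] at this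
    rw [← this]; group
  have w1 := wt f1.toFinset
  have w2 := wt f2.toFinset
  have e1 : K2 d g = f1.toFinset.card + f2.toFinset.card := by
    simp [K2, Set.ncard_eq_toFinset_card _ f1, Set.ncard_eq_toFinset_card _ f2]
  have l1 : ℓ g ≤ ℓ V + ℓ W := by
    rw [hg', ← hℓ.inv V]; exact hℓ.mul _ _
  have w1' := hW.trans (Nat.mul_le_mul_left C w1)
  have w2' := hV.trans (Nat.mul_le_mul_left C w2)
  rw [e1]
  calc ℓ g ≤ C * ((2 * d + 1) * f2.toFinset.card + 2 * d) + C * ((2 * d + 1) * f1.toFinset.card + 2 * d) := by omega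
    _ = C * ((2 * d + 1) * (f1.toFinset.card + f2.toFinset.card) + 4 * d) := by ring
    _ ≤ C * ((4 * d + 1) * (f1.toFinset.card + f2.toFinset.card) + (4 * d + 1)) := by
        apply Nat.mul_le_mul_left
        have : (2 * d + 1) * (f1.toFinset.card + f2.toFinset.card) ≤ (4 * d + 1) * (f1.toFinset.card + f2.toFinset.card) :=
          Nat.mul_le_mul_right _ (by omega)
        omega
    _ = _ := by ring


theorem stepB {d : ℕ} (hd : 1 ≤ d) {ℓ : Tn (d + 1) → ℕ} (hℓ : IsLen ℓ) :
    ∃ C, ∀ u : List (Fin (d + 1)), u ≠ [] → ∃ y : Tn (d + 1),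
      Carry (y : Circle ≃ₜ Circle) [Fin.last d] u ∧ ℓ y ≤ C * u.length := by
  have hne : (d : ℝ) + 1 ≠ 0 := by positivity
  have base : ∀ i : Fin (d + 1), ∃ y : Tn (d + 1), Carry (y : Circle ≃ₜ Circle) [Fin.last d] [i] := by
    intro i
    refine ⟨⟨_, rot_mem hd (((i : ℕ) - (d : ℤ)) * ((d : ℤ) + 1))⟩, rot_carry _ _ _ rfl 0 ?_⟩
    simp only [aff, Fin.val_last]; push_cast; field_simp; ring
  have step : ∀ i : Fin (d + 1), ∃ y : Tn (d + 1), Carry (y : Circle ≃ₜ Circle) [Fin.last d] [Fin.last d, i] := by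
    intro i
    obtain ⟨f, hf, _, _, _, h4⟩ := exists_gen hd 0 (by omega)
    refine ⟨⟨_, rot_mem hd ((i : ℕ) - (d : ℤ))⟩ * ⟨f, hf⟩, Carry.comp (u := [Fin.last d, Fin.last d]) (rot_carry _ _ _ (by simp) 0 ?_) (h4 (by omega))⟩
    simp only [aff, Fin.val_last]; push_cast; field_simp; ring
  choose a ha using base
  choose b hb using step
  refine ⟨Finset.univ.sup (fun i => ℓ (a i)) + Finset.univ.sup (fun i => ℓ (b i)), fun u => ?_⟩
  induction u using List.reverseRecOn with
  | nil => intro h; exact absurd rfl h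
  | append_singleton u i ih =>
    intro _
    have h1 := Finset.le_sup (f := fun i => ℓ (a i)) (Finset.mem_univ i)
    have h2 := Finset.le_sup (f := fun i => ℓ (b i)) (Finset.mem_univ i)

    by_cases hu : u = []
    · subst hu
      refine ⟨a i, ha i, ?_⟩
      simp; omega
    · obtain ⟨y, hy, hl⟩ := ih hu
      refine ⟨y * b i, Carry.comp (by simpa using hy.append [i]) (hb i), ?_⟩
      have := hℓ.mul y (b i)
      rw [List.length_append, List.length_singleton, mul_add, mul_one]
      omega

theorem linear_bound {d : ℕ} (hd : 1 ≤ d) {ℓ : Tn (d + 1) → ℕ} (hℓ : IsLen ℓ) :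
    ∃ C, ∀ g : Tn (d + 1), ℓ g ≤ C * K2 d g + C := by
  classical
  obtain ⟨C, hC⟩ := stepC hd hℓ
  have hK := isLen_K2 hd
  obtain ⟨C1, hC1⟩ := stepB hd (hℓ.add hK)
  refine ⟨C + C * C1 * 2 + C1 * 2, fun g => ?_⟩
  have f1 := Irr_finite_of_mem hd g.2
  have f2 := Irr_inv_finite f1
  have hex : ∃ j, ∃ u, Carry (g : Circle ≃ₜ Circle) (List.replicate j (Fin.last d)) u := by
    obtain ⟨k, hk⟩ := exists_reg f1
    exact ⟨k, hk _ (by simp)⟩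
  obtain ⟨u, hu⟩ := Nat.find_spec hex
  have hmin := fun i (h : i < Nat.find hex) => Nat.find_min hex h
  generalize Nat.find hex = j at hu hmin
  have hj : j ≤ (Irr d (g : Circle ≃ₜ Circle)).ncard := by
    have : ((Finset.range j).image (fun i => List.replicate i (Fin.last d)) : Set (List (Fin (d + 1)))).ncard = j := by
      rw [Set.ncard_coe_finset, Finset.card_image_of_injective, Finset.card_range]
      intro a b h
      simpa using congrArg List.length h
    rw [← this]
    refine Set.ncard_le_ncard ?_ f1
    intro v hv
    simp at hv
    obtain ⟨i, hi, rfl⟩ := hv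
    exact hmin i hi
  have hul : u.length ≤ (Irr d (g : Circle ≃ₜ Circle)⁻¹).ncard := by
    have : ((Finset.range u.length).image (fun i => u.take i) : Set (List (Fin (d + 1)))).ncard = u.length := by
      rw [Set.ncard_coe_finset, Finset.card_image_of_injOn, Finset.card_range]
      intro a ha b hb h
      have := congrArg List.length h
      simp at this ha hb
      omega
    rw [← this]
    refine Set.ncard_le_ncard ?_ f2
    intro v hv
    simp at hv
    obtain ⟨i, hi, rfl⟩ := hv
    rintro ⟨w, hw⟩
    have h1 := hw.append (u.drop i)
    rw [List.take_append_drop] at h1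
    have h2 := Carry.unique hd h1 hu.inv
    have h3 := congrArg List.length h2
    simp at h3
    have h4 : w = List.replicate w.length (Fin.last d) := by
      rw [List.eq_replicate_iff]
      refine ⟨rfl, fun b hb => ?_⟩
      have : b ∈ List.replicate j (Fin.last d) := by rw [← h2]; simp [hb]
      exact List.eq_of_mem_replicate this
    refine hmin w.length (by omega) ⟨u.take i, ?_⟩
    rw [← h4]
    simpa using hw.inv
  obtain ⟨yv, hyv, lv⟩ := hC1 (List.replicate j (Fin.last d) ++ [Fin.last d]) (by simp)
  obtain ⟨yu, hyu, lu⟩ := hC1 (u ++ [Fin.last d]) (by simp)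
  have hc := hC (yu⁻¹ * g * yv) ((hyu.inv.comp (hu.append _)).comp hyv)
  simp only [List.length_append, List.length_replicate, List.length_singleton] at lv lu
  have hg : g = yu * (yu⁻¹ * g * yv) * yv⁻¹ := by group
  have l1 : ℓ g ≤ ℓ yu + ℓ (yu⁻¹ * g * yv) + ℓ yv := by
    conv_lhs => rw [hg]
    have a1 := hℓ.mul (yu * (yu⁻¹ * g * yv)) yv⁻¹
    have a2 := hℓ.mul yu (yu⁻¹ * g * yv)
    rw [hℓ.inv] at a1
    omega
  have l2 : K2 d (yu⁻¹ * g * yv) ≤ K2 d yu + K2 d g + K2 d yv := by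
    have a1 := hK.mul (yu⁻¹ * g) yv
    have a2 := hK.mul yu⁻¹ g
    rw [hK.inv] at a2
    omega
  have l3 : j + u.length ≤ K2 d g := by unfold K2; omega
  have l4 : C1 * (j + 1) + C1 * (u.length + 1) ≤ C1 * (K2 d g + 2) := by
    rw [← mul_add]; exact Nat.mul_le_mul_left _ (by omega)
  have l5 := Nat.mul_le_mul_left C l2
  have l6 : C * (K2 d yu + K2 d g + K2 d yv) ≤ C * (K2 d g + C1 * (K2 d g + 2)) :=
    Nat.mul_le_mul_left _ (by omega)
  have l7 : ℓ yu + ℓ yv ≤ C1 * (K2 d g + 2) := by omega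
  calc ℓ g ≤ C1 * (K2 d g + 2) + (C * (K2 d g + C1 * (K2 d g + 2)) + C) := by omega
    _ ≤ _ := by nlinarith [Nat.zero_le (C * C1 * K2 d g), Nat.zero_le (C1 * K2 d g)]


/-- Subdivision of the unit interval into consecutive affine pieces. -/
structure IFS (D : ℕ) where
  s : Fin (D + 1) → ℝ
  c : Fin (D + 1) → ℝ
  pos : ∀ j, 0 < c j
  half : ∀ j, c j ≤ 1 / 2
  s0 : s 0 = 0
  adj : ∀ j : Fin D, s j.castSucc + c j.castSucc = s j.succ
  last : s (Fin.last D) + c (Fin.last D) = 1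

namespace IFS
variable {D : ℕ}

theorem mono (A : IFS D) : Monotone A.s := by
  rw [Fin.monotone_iff_le_succ]
  intro j
  rw [← A.adj]; linarith [A.pos j.castSucc]

theorem lt (A : IFS D) {j k : Fin (D + 1)} (h : j < k) : A.s j + A.c j ≤ A.s k := by
  induction j using Fin.lastCases with
  | last => exact absurd k.le_last (not_le.2 h)
  | cast j => rw [A.adj]; exact A.mono (Fin.castSucc_lt_iff_succ_le.1 h)

theorem s_nonneg (A : IFS D) (j) : 0 ≤ A.s j := by rw [← A.s0]; exact A.mono (Fin.zero_le _)

theorem sc_le (A : IFS D) (j) : A.s j + A.c j ≤ 1 := by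
  rcases j.le_last.lt_or_eq with h | rfl
  · have := A.lt h
    have := A.last
    have := A.pos (Fin.last D)
    linarith
  · exact A.last.le

theorem cover (A : IFS D) (x : ℝ) (hx : x ∈ Set.Ico (0 : ℝ) 1) :
    ∃ j, ∃ y ∈ Set.Ico (0 : ℝ) 1, x = A.s j + A.c j * y := by
  classical
  suffices h : ∃ j, A.s j ≤ x ∧ x < A.s j + A.c j by
    obtain ⟨j, h1, h2⟩ := h
    have hp := A.pos j
    refine ⟨j, (x - A.s j) / A.c j, ⟨by apply div_nonneg <;> linarith, ?_⟩, by field_simp; ring⟩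
    rw [div_lt_one hp]; linarith
  let S := Finset.univ.filter (fun j => A.s j ≤ x)
  have hS : S.Nonempty := ⟨0, by simp [S, A.s0, hx.1]⟩
  have h1 := S.max'_mem hS
  refine ⟨S.max' hS, by simpa [S] using h1, ?_⟩
  have h2 : ∀ k ∈ S, k ≤ S.max' hS := fun k hk => S.le_max' k hk
  generalize S.max' hS = j at h2
  induction j using Fin.lastCases with
  | last => rw [A.last]; exact hx.2
  | cast j =>
    rw [A.adj]
    by_contra hc
    have := h2 j.succ (by simp [S]; linarith)
    exact absurd this (not_le.2 (Fin.castSucc_lt_succ (i := j)))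

/-- base points of words -/
def wp (A : IFS D) : List (Fin (D + 1)) → ℝ
  | [] => 0
  | j :: w => A.s j + A.c j * A.wp w

theorem wp_mem (A : IFS D) (w) : A.wp w ∈ Set.Ico (0 : ℝ) 1 := by
  induction w with
  | nil => simp [wp]
  | cons j w ih =>
    have h1 := A.s_nonneg j
    have h2 := A.pos j
    have h3 := A.sc_le j
    simp only [wp]
    constructor
    · have := mul_nonneg h2.le ih.1; linarith
    · have := mul_lt_mul_of_pos_left ih.2 h2; linarith

/-- the conjugating map -/
def HH (A B : IFS D) (x : ℝ) : ℝ := sSup {t | ∃ w, A.wp w ≤ x ∧ t = B.wp w}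

theorem HH_bdd (A B : IFS D) (x : ℝ) : BddAbove {t | ∃ w, A.wp w ≤ x ∧ t = B.wp w} :=
  ⟨1, by rintro _ ⟨w, _, rfl⟩; exact (B.wp_mem w).2.le⟩

theorem HH_ne (A B : IFS D) {x : ℝ} (hx : 0 ≤ x) : {t | ∃ w, A.wp w ≤ x ∧ t = B.wp w}.Nonempty :=
  ⟨0, [], hx, rfl⟩

theorem le_HH (A B : IFS D) {x : ℝ} {w} (h : A.wp w ≤ x) : B.wp w ≤ HH A B x :=
  le_csSup (HH_bdd A B x) ⟨w, h, rfl⟩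

theorem HH_le (A B : IFS D) {x b : ℝ} (hx : 0 ≤ x) (h : ∀ w, A.wp w ≤ x → B.wp w ≤ b) :
    HH A B x ≤ b :=
  csSup_le (HH_ne A B hx) (by rintro _ ⟨w, hw, rfl⟩; exact h w hw)

theorem HH_nonneg (A B : IFS D) {x : ℝ} (hx : 0 ≤ x) : 0 ≤ HH A B x :=
  le_HH A B (w := []) hx

theorem HH_le_one (A B : IFS D) {x : ℝ} (hx : 0 ≤ x) : HH A B x ≤ 1 :=
  HH_le A B hx fun w _ => (B.wp_mem w).2.le

theorem HH_mono (A B : IFS D) {x y : ℝ} (hx : 0 ≤ x) (h : x ≤ y) : HH A B x ≤ HH A B y :=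
  HH_le A B hx fun _ hw => le_HH A B (hw.trans h)

theorem HH_R (A B : IFS D) (j) {y : ℝ} (hy : y ∈ Set.Ico (0 : ℝ) 1) :
    HH A B (A.s j + A.c j * y) = B.s j + B.c j * HH A B y := by
  have hA := A.pos j
  have hB := B.pos j
  have h0 : 0 ≤ A.s j + A.c j * y := by
    have := A.s_nonneg j; have := mul_nonneg hA.le hy.1; linarith
  have hHy := HH_nonneg A B hy.1
  have hcH := mul_nonneg hB.le hHy
  apply le_antisymm
  · apply HH_le A B h0
    intro w hw
    cases w with
    | nil => have := B.s_nonneg j; simp only [wp]; linarith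
    | cons k w =>
      simp only [wp] at hw ⊢
      rcases lt_trichotomy k j with h | rfl | h
      · have h1 := B.lt h
        have h2 := mul_lt_mul_of_pos_left (B.wp_mem w).2 (B.pos k)
        linarith
      · have h1 : A.wp w ≤ y := le_of_mul_le_mul_left (by linarith) hA
        have := mul_le_mul_of_nonneg_left (le_HH A B h1) hB.le
        linarith
      · have h1 := A.lt h
        have h2 := mul_nonneg (A.pos k).le (A.wp_mem w).1
        have h3 := mul_lt_mul_of_pos_left hy.2 hA
        linarith
  · have : HH A B y ≤ (HH A B (A.s j + A.c j * y) - B.s j) / B.c j := by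
      apply HH_le A B hy.1
      intro w hw
      have h1 : A.wp (j :: w) ≤ A.s j + A.c j * y := by
        simp only [wp]; have := mul_le_mul_of_nonneg_left hw hA.le; linarith
      have h2 := le_HH A B h1
      simp only [wp] at h2
      rw [le_div_iff₀ hB]; linarith
    rw [le_div_iff₀ hB] at this
    linarith

theorem HH_lt_one (A B : IFS D) {x : ℝ} (hx : x ∈ Set.Ico (0 : ℝ) 1) : HH A B x < 1 := by
  have key : ∀ k : ℕ, ∀ x ∈ Set.Ico (0 : ℝ) 1, 1 < 2 ^ k * (1 - x) → HH A B x < 1 := by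
    intro k
    induction k with
    | zero => intro x hx h; simp only [pow_zero, one_mul] at h; linarith [hx.1]
    | succ k ih =>
      intro x hx h
      obtain ⟨j, y, hy, rfl⟩ := A.cover x hx
      rw [HH_R A B j hy]
      have hB := B.pos j
      rcases j.le_last.lt_or_eq with hj | rfl
      · have h1 := B.lt hj
        have h2 := mul_le_mul_of_nonneg_left (HH_le_one A B hy.1) hB.le
        have := B.last
        have := B.pos (Fin.last D)
        linarith
      · have hA := A.half (Fin.last D)
        have hl := A.last
        have h1 := ih y hy (by
          have : (1 : ℝ) - (A.s (Fin.last D) + A.c (Fin.last D) * y) = A.c (Fin.last D) * (1 - y) := by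
            linarith
          rw [this] at h
          have h2 : A.c (Fin.last D) * (1 - y) ≤ 1 / 2 * (1 - y) :=
            mul_le_mul_of_nonneg_right hA (by linarith [hy.2])
          have h3 : (2 : ℝ) ^ (k + 1) * (A.c (Fin.last D) * (1 - y)) ≤ 2 ^ (k + 1) * (1 / 2 * (1 - y)) :=
            mul_le_mul_of_nonneg_left h2 (by positivity)
          rw [pow_succ] at h h3
          linarith)
        have := mul_lt_mul_of_pos_left h1 hB
        have := B.last
        linarith
  obtain ⟨k, hk⟩ := pow_unbounded_of_one_lt (1 / (1 - x)) (one_lt_two (α := ℝ))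
  refine key k x hx ?_
  rwa [div_lt_iff₀ (by linarith [hx.2])] at hk

theorem HH_mem (A B : IFS D) {x : ℝ} (hx : x ∈ Set.Ico (0 : ℝ) 1) : HH A B x ∈ Set.Ico (0 : ℝ) 1 :=
  ⟨HH_nonneg A B hx.1, HH_lt_one A B hx⟩

theorem HH_HH (A B : IFS D) {x : ℝ} (hx : x ∈ Set.Ico (0 : ℝ) 1) : HH B A (HH A B x) = x := by
  have key : ∀ k : ℕ, ∀ x ∈ Set.Ico (0 : ℝ) 1, |HH B A (HH A B x) - x| ≤ (1 / 2) ^ k := by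
    intro k
    induction k with
    | zero =>
      intro x hx
      have := HH_mem B A (HH_mem A B hx)
      rw [abs_le]; constructor <;> linarith [this.1, this.2, hx.1, hx.2]
    | succ k ih =>
      intro x hx
      obtain ⟨j, y, hy, rfl⟩ := A.cover x hx
      rw [HH_R A B j hy, HH_R B A j (HH_mem A B hy)]
      rw [add_sub_add_left_eq_sub, ← mul_sub, abs_mul, abs_of_pos (A.pos j), pow_succ, mul_comm]
      exact mul_le_mul (ih y hy) (A.half j) (A.pos j).le (by positivity)
  by_contra hne
  have hpos : 0 < |HH B A (HH A B x) - x| := abs_pos.2 (sub_ne_zero.2 hne)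
  obtain ⟨k, hk⟩ := exists_pow_lt_of_lt_one hpos (by norm_num : (1 / 2 : ℝ) < 1)
  exact absurd (key k x hx) (not_le.2 hk)

theorem HH_zero (A B : IFS D) : HH A B 0 = 0 := by
  have h := HH_R A B 0 (y := 0) (by norm_num)
  rw [A.s0, B.s0] at h
  simp only [mul_zero, add_zero, zero_add] at h
  have h1 := B.half 0
  have h2 := HH_nonneg A B (le_refl 0)
  nlinarith

theorem conj (A B : IFS D) : ∃ E : ℝ ≃o ℝ, (∀ x, E (x + 1) = E x + 1) ∧ E 0 = 0 ∧ E 1 = 1 ∧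
    ∀ j, ∀ y ∈ Set.Icc (0 : ℝ) 1, E (A.s j + A.c j * y) = B.s j + B.c j * E y := by
  classical
  let F : ℝ → ℝ := fun x => if x < 1 then HH A B x else 1
  have F0 : F 0 = 0 := by simp [F, HH_zero]
  have F1 : F 1 = 1 := by simp [F]
  have Flt : ∀ x, x < 1 → F x = HH A B x := fun x hx => by simp [F, hx]
  obtain ⟨E, hE, hEF⟩ := exists_extend F F0 F1 (by
    intro x hx y hy hxy
    have hx1 : x < 1 := lt_of_lt_of_le hxy hy.2
    rw [Flt x hx1]
    rcases hy.2.lt_or_eq with h | rfl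
    · rw [Flt y h]
      refine (HH_mono A B hx.1 hxy.le).lt_of_ne fun e => ?_
      have := congrArg (HH B A) e
      rw [HH_HH A B ⟨hx.1, hx1⟩, HH_HH A B ⟨hy.1, h⟩] at this
      exact hxy.ne this
    · rw [F1]; exact HH_lt_one A B ⟨hx.1, hx1⟩) (by
    intro y hy
    refine ⟨HH B A y, HH_mem B A hy, ?_⟩
    rw [Flt _ (HH_lt_one B A hy), HH_HH B A hy])
  have hR : ∀ j, ∀ y ∈ Set.Icc (0 : ℝ) 1, A.s j + A.c j * y ∈ Set.Icc (0 : ℝ) 1 := by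
    intro j y hy
    have h1 := A.s_nonneg j
    have h2 := A.pos j
    have h3 := A.sc_le j
    have h4 := mul_nonneg h2.le hy.1
    have h5 := mul_le_mul_of_nonneg_left hy.2 h2.le
    constructor <;> linarith
  have hlt : ∀ j, ∀ y ∈ Set.Ico (0 : ℝ) 1, F (A.s j + A.c j * y) = B.s j + B.c j * F y := by
    intro j y hy
    have h3 := A.sc_le j
    have h5 := mul_lt_mul_of_pos_left hy.2 (A.pos j)
    rw [Flt _ hy.2, Flt _ (by linarith), HH_R A B j hy]
  refine ⟨E, hE, by rw [hEF 0 (by norm_num), F0], by rw [hEF 1 (by norm_num), F1], fun j y hy => ?_⟩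
  rw [hEF _ (hR j y hy), hEF y hy]
  rcases hy.2.lt_or_eq with h | rfl
  · exact hlt j y ⟨hy.1, h⟩
  · rw [F1]
    induction j using Fin.lastCases with
    | last => rw [mul_one, mul_one, A.last, B.last, F1]
    | cast j =>
      rw [mul_one, mul_one, A.adj, B.adj]
      have := hlt j.succ 0 (by norm_num)
      rw [F0] at this
      simpa using this

end IFS


/-- the letter substitution -/
def rl (l e : ℕ) (j : Fin (l * e + 1)) : List (Fin (e + 1)) :=
  if (j : ℕ) < l * e then U e j else List.replicate l (Fin.last e)

theorem rl_lt {l e : ℕ} {j : Fin (l * e + 1)} (h : (j : ℕ) < l * e) : rl l e j = U e j := if_pos h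

theorem rl_last {l e : ℕ} : rl l e (Fin.last (l * e)) = List.replicate l (Fin.last e) :=
  if_neg (by simp)

theorem aff_U_mul {l e : ℕ} (he : 1 ≤ e) :
    aff (U e (l * e)) 0 = aff (List.replicate l (Fin.last e)) 0 := by
  have : l * e / e = l := Nat.mul_div_cancel l (by omega)
  simp [U, aff_append, aff, this]

theorem aff_rl_zero {l e : ℕ} (he : 1 ≤ e) (j : Fin (l * e + 1)) :
    aff (rl l e j) 0 = aff (U e j) 0 := by
  rcases Nat.lt_or_ge j (l * e) with h | h
  · rw [rl_lt h]
  · have hj : j = Fin.last (l * e) := Fin.ext (by have := j.2; simp; omega)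
    subst hj
    rw [rl_last, Fin.val_last, aff_U_mul he]

theorem rl_length {l e : ℕ} (hl : 1 ≤ l) (j : Fin (l * e + 1)) : 1 ≤ (rl l e j).length := by
  unfold rl
  split_ifs
  · simp [U]
  · simpa using hl

/-- standard subdivision -/
def stdIFS (d : ℕ) (hd : 1 ≤ d) : IFS d where
  s j := aff [j] 0
  c _ := 1 / ((d : ℝ) + 1)
  pos _ := by positivity
  half _ := by
    have : (1 : ℝ) ≤ d := by exact_mod_cast hd
    apply one_div_le_one_div_of_le <;> linarith
  s0 := by simp [aff]
  adj j := by simp [aff]; field_simp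
  last := by simp [aff]; field_simp

/-- substituted subdivision -/
def subIFS (l e : ℕ) (hl : 1 ≤ l) (he : 1 ≤ e) : IFS (l * e) where
  s j := aff (rl l e j) 0
  c j := 1 / ((e : ℝ) + 1) ^ (rl l e j).length
  pos _ := by positivity
  half j := by
    have h : (1 : ℝ) ≤ e := by exact_mod_cast he
    apply one_div_le_one_div_of_le (by norm_num)
    calc (2 : ℝ) ≤ (e : ℝ) + 1 := by linarith
      _ ≤ _ := le_self_pow₀ (by linarith) (by have := rl_length hl j; omega)
  s0 := by
    rw [aff_rl_zero he]
    rw [Fin.val_zero, U_lt (by omega)]; simp [aff]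
  adj j := by
    rw [← aff_eq, rl_lt (by simp), aff_U_adj he, aff_rl_zero he]
    simp
  last := by
    rw [← aff_eq, rl_last, aff_replicate]; simp

/-- the word substitution -/
def rwd (l e : ℕ) (v : List (Fin (l * e + 1))) : List (Fin (e + 1)) := v.flatMap (rl l e)

theorem rwd_append (l e : ℕ) (v w) : rwd l e (v ++ w) = rwd l e v ++ rwd l e w := by
  simp [rwd]

theorem exists_conj {l e : ℕ} (hl : 1 ≤ l) (he : 1 ≤ e) :
    ∃ E : ℝ ≃o ℝ, (∀ x, E (x + 1) = E x + 1) ∧ E 0 = 0 ∧ E 1 = 1 ∧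
      ∀ (v : List (Fin (l * e + 1))), ∀ x ∈ Set.Icc (0 : ℝ) 1, E (aff v x) = aff (rwd l e v) (E x) := by
  have hd : 1 ≤ l * e := Nat.mul_pos hl he
  obtain ⟨E, h1, h2, h3, h4⟩ := IFS.conj (stdIFS (l * e) hd) (subIFS l e hl he)
  refine ⟨E, h1, h2, h3, fun v x hx => ?_⟩
  induction v with
  | nil => rfl
  | cons j v ih =>
    have := h4 j _ (aff_mem_Icc v hx)
    simp only [stdIFS, subIFS] at this
    rw [ih] at this
    have e1 : aff (j :: v) x = aff [j] 0 + 1 / (((l * e : ℕ) : ℝ) + 1) * aff v x := by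
      simp only [aff]; ring
    rw [e1, this]
    have e2 : rwd l e (j :: v) = rl l e j ++ rwd l e v := by simp [rwd]
    rw [e2, aff_append, aff_eq (rl l e j) (aff (rwd l e v) (E x))]
    ring

theorem rwd_peel {l e : ℕ} (hl : 1 ≤ l) (he : 1 ≤ e) {u : List (Fin (l * e + 1))} {x}
    (h : rwd l e u = x ++ List.replicate l (Fin.last e)) :
    ∃ w, u = w ++ [Fin.last (l * e)] ∧ rwd l e w = x := by
  induction u using List.reverseRecOn with
  | nil => simp [rwd] at h; omega
  | append_singleton w j _ =>
    have e1 : rwd l e [j] = rl l e j := by simp [rwd]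
    rw [rwd_append, e1] at h
    rcases Nat.lt_or_ge j (l * e) with hj | hj
    · exfalso
      obtain ⟨l', rfl⟩ : ∃ l', l = l' + 1 := ⟨l - 1, by omega⟩
      rw [rl_lt hj, U, List.replicate_succ', ← List.append_assoc, ← List.append_assoc] at h
      have := (List.append_inj' h rfl).2
      simp [Fin.ext_iff] at this
      have h2 := Nat.mod_lt (j : ℕ) (show e > 0 by omega)
      rw [Nat.mod_eq_of_lt (by omega)] at this
      omega
    · have hj : j = Fin.last (l * e) := Fin.ext (by have := j.2; simp; omega)
      subst hj
      rw [rl_last] at h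
      exact ⟨w, rfl, List.append_cancel_right h⟩

theorem rwd_peel_many {l e : ℕ} (hl : 1 ≤ l) (he : 1 ≤ e) (k : ℕ) {u : List (Fin (l * e + 1))} {x}
    (h : rwd l e u = x ++ rwd l e (List.replicate k (Fin.last (l * e)))) :
    ∃ w, u = w ++ List.replicate k (Fin.last (l * e)) ∧ rwd l e w = x := by
  induction k generalizing u x with
  | zero => exact ⟨u, by simp, by simpa [rwd] using h⟩
  | succ k ih =>
    rw [List.replicate_succ', rwd_append, ← List.append_assoc] at h
    have e1 : rwd l e [Fin.last (l * e)] = List.replicate l (Fin.last e) := by simp [rwd, rl_last]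
    rw [e1] at h
    obtain ⟨w, rfl, hw⟩ := rwd_peel hl he h
    obtain ⟨w', rfl, hw'⟩ := ih hw
    exact ⟨w', by rw [List.replicate_succ', List.append_assoc], hw'⟩

theorem parse_one {l e : ℕ} (he : 1 ≤ e) (w : List (Fin (e + 1))) (h : l ≤ w.length) :
    ∃ j s, w = rl l e j ++ s ∧ w.length ≤ s.length + l := by
  rcases spine_or he w with ⟨q, rfl⟩ | ⟨i, s, rfl⟩
  · simp at h
    refine ⟨Fin.last _, List.replicate (q - l) (Fin.last e), ?_, by simp; omega⟩
    rw [rl_last, ← List.replicate_add]; congr 1; omega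
  · rcases Nat.lt_or_ge i (l * e) with hi | hi
    · refine ⟨⟨i, by omega⟩, s, by rw [rl_lt hi], ?_⟩
      have : i / e < l := by rw [Nat.div_lt_iff_lt_mul (by omega)]; exact hi
      simp [U]; omega
    · have h1 : l ≤ i / e := by rw [Nat.le_div_iff_mul_le (by omega)]; exact hi
      refine ⟨Fin.last _, List.replicate (i / e - l) (Fin.last e) ++ [Fin.ofNat (e + 1) (i % e)] ++ s, ?_, ?_⟩
      · rw [rl_last, U, ← List.append_assoc, ← List.append_assoc, ← List.replicate_add]
        congr 4; omega
      · simp [U]; omega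

theorem parse {l e : ℕ} (he : 1 ≤ e) (k : ℕ) (w : List (Fin (e + 1))) (h : k * l ≤ w.length) :
    ∃ v s, w = rwd l e v ++ s ∧ v.length = k := by
  induction k generalizing w with
  | zero => exact ⟨[], w, rfl, rfl⟩
  | succ k ih =>
    rw [Nat.succ_mul] at h
    obtain ⟨j, s, rfl, hs⟩ := parse_one (l := l) he w (by omega)
    obtain ⟨v, s', rfl, hv⟩ := ih s (by omega)
    exact ⟨j :: v, s', by simp [rwd], by simp [hv]⟩

theorem conj_carry {l e : ℕ} (E : ℝ ≃o ℝ) (hE : ∀ x, E (x + 1) = E x + 1) (h0 : E 0 = 0) (h1 : E 1 = 1)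
    (hc : ∀ (v : List (Fin (l * e + 1))), ∀ x ∈ Set.Icc (0 : ℝ) 1, E (aff v x) = aff (rwd l e v) (E x))
    {f : Circle ≃ₜ Circle} {v u : List (Fin (l * e + 1))} (h : Carry f v u) :
    Carry (circ E hE * f * (circ E hE)⁻¹) (rwd l e v) (rwd l e u) := by
  intro y hy
  obtain ⟨x, rfl⟩ := E.surjective y
  have hx : x ∈ Set.Icc (0 : ℝ) 1 := by
    rw [← h0, ← h1] at hy
    exact ⟨E.le_iff_le.1 hy.1, E.le_iff_le.1 hy.2⟩
  rw [← hc v x hx, ← hc u x hx, hmul_apply, hmul_apply, circ_inv_coe, E.symm_apply_apply, h x hx,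
    circ_coe]


theorem conj_carry_back {l e : ℕ} (E : ℝ ≃o ℝ) (hE : ∀ x, E (x + 1) = E x + 1) (h0 : E 0 = 0) (h1 : E 1 = 1)
    (hc : ∀ (v : List (Fin (l * e + 1))), ∀ x ∈ Set.Icc (0 : ℝ) 1, E (aff v x) = aff (rwd l e v) (E x))
    {f : Circle ≃ₜ Circle} {v u : List (Fin (l * e + 1))}
    (h : Carry (circ E hE * f * (circ E hE)⁻¹) (rwd l e v) (rwd l e u)) : Carry f v u := by
  intro x hx
  have hy : E x ∈ Set.Icc (0 : ℝ) 1 := by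
    rw [← h0, ← h1]; exact ⟨E.monotone hx.1, E.monotone hx.2⟩
  have := h (E x) hy
  rw [← hc v x hx, ← hc u x hx, hmul_apply, hmul_apply, circ_inv_coe, E.symm_apply_apply,
    ← circ_coe E hE] at this
  exact (circ E hE).injective this

theorem rwd_inj {l e : ℕ} (hl : 1 ≤ l) (he : 1 ≤ e) : Function.Injective (rwd l e) := by
  obtain ⟨E, hE, h0, h1, hc⟩ := exists_conj hl he
  intro v w h
  refine aff_inj (Nat.mul_pos hl he) v w fun x hx => ?_
  apply E.injective
  rw [hc v x ⟨hx.1, hx.2.le⟩, hc w x ⟨hx.1, hx.2.le⟩, h]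

theorem exists_phi {l e : ℕ} (hl : 1 ≤ l) (he : 1 ≤ e) :
    ∃ φ : Tn (l * e + 1) →* Tn (e + 1), Function.Injective φ ∧
      ∀ g, K2 (l * e) g ≤ K2 e (φ g) := by
  have hd : 1 ≤ l * e := Nat.mul_pos hl he
  obtain ⟨E, hE, h0, h1, hc⟩ := exists_conj hl he
  set h := circ E hE with hh
  have hmem : ∀ f ∈ Tn (l * e + 1), h * f * h⁻¹ ∈ Tn (e + 1) := by
    have : Tn (l * e + 1) ≤ (Tn (e + 1)).comap (MulAut.conj h).toMonoidHom := by
      refine (Subgroup.closure_le _).2 ?_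
      intro f hf
      obtain ⟨G, hG, hGl⟩ := exists_orderIso_lift (n := l * e + 1) hf
      have hfin : (Irr (l * e) f).Finite := Irr_finite_of_InT hf
      obtain ⟨k, hk⟩ := exists_reg hfin
      change h * f * h⁻¹ ∈ Tn (e + 1)
      refine mem_Tn_of he (Irr_finite_of (k := k * l) fun w hw => ?_) (E.symm.trans (G.trans E)) ?_ ?_
      · obtain ⟨v, s, rfl, hv⟩ := parse he k w hw
        obtain ⟨u, hu⟩ := hk v hv.ge
        exact ⟨_, (conj_carry E hE h0 h1 hc hu).append s⟩
      · intro x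
        simp only [OrderIso.trans_apply]
        rw [symm_add_one hE, hG, hE]
      · intro x
        rw [hmul_apply, hmul_apply, hh, circ_inv_coe, hGl, circ_coe]
        rfl
    exact fun f hf => this hf
  have hirr : ∀ f ∈ Tn (l * e + 1), (Irr (l * e) f).ncard ≤ (Irr e (h * f * h⁻¹)).ncard := by
    intro f hf
    refine Set.ncard_le_ncard_of_injOn (rwd l e) ?_ ((rwd_inj hl he).injOn)
      (Irr_finite_of_mem he (hmem f hf))
    rintro v hv ⟨u', hu'⟩
    obtain ⟨k, hk⟩ := exists_reg (Irr_finite_of_mem hd hf)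
    obtain ⟨u, hu⟩ := hk (v ++ List.replicate k (Fin.last (l * e))) (by simp)
    have a1 := conj_carry E hE h0 h1 hc hu
    rw [rwd_append] at a1
    have a2 := Carry.unique he a1 (hu'.append _)
    obtain ⟨w, rfl, rfl⟩ := rwd_peel_many hl he k a2
    exact hv ⟨w, conj_carry_back E hE h0 h1 hc hu'⟩
  refine ⟨MonoidHom.mk' (fun g => ⟨h * g * h⁻¹, hmem g g.2⟩) ?_, ?_, ?_⟩
  · intro a b
    apply Subtype.ext
    simp
  · intro a b hab
    have := congrArg Subtype.val hab
    apply Subtype.ext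
    simpa using this
  · intro g
    have a := hirr g g.2
    have b := hirr _ (inv_mem g.2)
    have e1 : (h * (g : Circle ≃ₜ Circle) * h⁻¹)⁻¹ = h * (g : Circle ≃ₜ Circle)⁻¹ * h⁻¹ := by group
    simp only [K2, MonoidHom.mk'_apply]
    rw [e1]
    exact add_le_add a b

/-- Let `m ≥ 2` and `l ≥ 1` be integers and set `n = l(m-1)+1`.
There exists an injective group homomorphism `φ` from `T_n` into `T_m` which is a
quasi-isometric embedding: for any finite generating set `Σ` of `T_n` and any finite
generating set `S` of `T_m`, there exist constants `A ≥ 1` and `B ≥ 0` such that for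
all `ω ∈ T_n`, `(1/A)·|ω|_Σ - B ≤ |φ(ω)|_S ≤ A·|ω|_Σ + B`. -/
theorem qi_embedding_Tn_to_Tm (m l : ℕ) (hm : 2 ≤ m) (hl : 1 ≤ l)
    (n : ℕ) (hn : n = l * (m - 1) + 1) :
    ∃ φ : Tn n →* Tn m, Function.Injective φ ∧
      ∀ T : Finset (Tn n), Subgroup.closure (T : Set (Tn n)) = ⊤ →
      ∀ S : Finset (Tn m), Subgroup.closure (S : Set (Tn m)) = ⊤ →
      ∃ A B : ℝ, 1 ≤ A ∧ 0 ≤ B ∧ ∀ ω : Tn n,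
        (1 / A) * (wordLength (T : Set (Tn n)) ω : ℝ) - B ≤
            (wordLength (S : Set (Tn m)) (φ ω) : ℝ) ∧
        (wordLength (S : Set (Tn m)) (φ ω) : ℝ) ≤
            A * (wordLength (T : Set (Tn n)) ω : ℝ) + B := by
  obtain ⟨e, rfl⟩ : ∃ e, m = e + 1 := ⟨m - 1, by omega⟩
  have he : 1 ≤ e := by omega
  rw [Nat.add_sub_cancel] at hn
  subst hn
  have hd : 1 ≤ l * e := Nat.mul_pos hl he
  obtain ⟨φ, hφ, hK⟩ := exists_phi hl he
  refine ⟨φ, hφ, fun T hT S hS => ?_⟩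
  obtain ⟨C, hC⟩ := linear_bound hd (isLen_wordLength (T : Set (Tn (l * e + 1))) hT)
  obtain ⟨C', hC'⟩ := (isLen_K2 he).le_wordLength S hS
  obtain ⟨C2, hC2⟩ := ((isLen_wordLength (S : Set (Tn (e + 1))) hS).comp φ).le_wordLength T hT
  refine ⟨((C * C' + C + C2 + 1 : ℕ) : ℝ), 1, ?_, zero_le_one, fun ω => ?_⟩
  · push_cast
    have : (0 : ℝ) ≤ (C : ℝ) * C' + C + C2 := by positivity
    linarith
  have hA : (0 : ℝ) < ((C * C' + C + C2 + 1 : ℕ) : ℝ) := by positivity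
  constructor
  · have a1 := hC ω
    have a2 := Nat.mul_le_mul_left C ((hK ω).trans (hC' (φ ω)))
    have a3 : wordLength (T : Set (Tn (l * e + 1))) ω ≤
        (C * C' + C + C2 + 1) * (wordLength (S : Set (Tn (e + 1))) (φ ω) + 1) := by
      have : C * (C' * wordLength (S : Set (Tn (e + 1))) (φ ω)) + C ≤
        (C * C' + C + C2 + 1) * (wordLength (S : Set (Tn (e + 1))) (φ ω) + 1) := by
        generalize wordLength (S : Set (Tn (e + 1))) (φ ω) = t
        nlinarith [Nat.zero_le (C * t), Nat.zero_le (C2 * t), Nat.zero_le (C * C'), Nat.zero_le C2, Nat.zero_le t]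
      omega
    have a4 : (wordLength (T : Set (Tn (l * e + 1))) ω : ℝ) ≤
        ((C * C' + C + C2 + 1 : ℕ) : ℝ) * ((wordLength (S : Set (Tn (e + 1))) (φ ω) : ℝ) + 1) := by
      exact_mod_cast a3
    rw [one_div, sub_le_iff_le_add, inv_mul_le_iff₀ hA]
    exact a4
  · have a1 := hC2 ω
    have a2 : wordLength (S : Set (Tn (e + 1))) (φ ω) ≤
        (C * C' + C + C2 + 1) * wordLength (T : Set (Tn (l * e + 1))) ω + 1 := by
      have : C2 * wordLength (T : Set (Tn (l * e + 1))) ω ≤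
        (C * C' + C + C2 + 1) * wordLength (T : Set (Tn (l * e + 1))) ω :=
        Nat.mul_le_mul_right _ (by omega)
      omega
    exact_mod_cast a2

end ThompsonPaper
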